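/- arXiv:2512.20001 — 6 statements merged into one kernel-verified Lean document; each statement's English description precedes it below -/
import Mathlib

section
/- Let μ and ν be finite signed measures on a compact interval [a,b] with a < b, and define H(x) = μ([a,x]) and G(x) = ν([a,x]) for x ∈ [a,b]. If H(b) = G(b), then μ dominates ν in convex order if and only if G majorizes H. -/
open MeasureTheory Set

noncomputable section

/-- Integral of a function against a signed measure over a set,
via the Jordan decomposition. -/
def signedIntegral (μ : MeasureTheory.SignedMeasure ℝ) (E : Set ℝ) (c : ℝ → ℝ) : ℝ :=
  (∫ t in E, c t ∂μ.toJordanDecomposition.posPart) -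
    (∫ t in E, c t ∂μ.toJordanDecomposition.negPart)

lemma jordan_apply (μ : SignedMeasure ℝ) (E : Set ℝ) (hE : MeasurableSet E) :
    μ E = μ.toJordanDecomposition.posPart.real E - μ.toJordanDecomposition.negPart.real E := by
  conv_lhs => rw [← SignedMeasure.toSignedMeasure_toJordanDecomposition μ]
  simp [JordanDecomposition.toSignedMeasure, Measure.toSignedMeasure_apply_measurable hE]

lemma inner_int (a x s : ℝ) (has : a ≤ s) :
    ∫ t in Ioc a x, (Iic t).indicator (fun _ => (1:ℝ)) s = max (x - s) 0 := by
  have : (fun t : ℝ => (Iic t).indicator (fun _ => (1:ℝ)) s) =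
      (Ici s).indicator (fun _ => (1:ℝ)) := by
    ext t; simp [indicator]
  rw [this, setIntegral_indicator measurableSet_Ici]
  simp only [integral_const, smul_eq_mul, mul_one, MeasurableSet.univ, measureReal_restrict_apply, univ_inter]
  have h : (Ioc a x ∩ Ici s : Set ℝ) =ᵐ[volume] Icc s x := by
    rcases has.eq_or_lt with rfl | h
    · have : (Ioc a x ∩ Ici a : Set ℝ) = Ioc a x := by
        ext t; simp only [mem_inter_iff, mem_Ioc, mem_Ici]; grind
      rw [this]; exact Ioc_ae_eq_Icc
    · have : (Ioc a x ∩ Ici s : Set ℝ) = Icc s x := by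
        ext t; simp only [mem_inter_iff, mem_Ioc, mem_Ici, mem_Icc]; grind
      rw [this]
      exact Filter.EventuallyEq.rfl
  rw [measureReal_congr h, Real.volume_real_Icc]

lemma potential (a b x : ℝ) (hx : x ∈ Icc a b) (ρ : Measure ℝ) [IsFiniteMeasure ρ] :
    IntervalIntegrable (fun t => ρ.real (Icc a t)) volume a x ∧
    ∫ t in a..x, ρ.real (Icc a t) = ∫ s in Icc a b, max (x - s) 0 ∂ρ := by
  constructor
  · apply MonotoneOn.intervalIntegrable
    intro s _ t _ hst
    exact measureReal_mono (Icc_subset_Icc_right hst)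
  rw [intervalIntegral.integral_of_le hx.1]
  have h1 : ∫ t in Ioc a x, ρ.real (Icc a t) =
      ∫ t in Ioc a x, ∫ s in Icc a b, (Iic t).indicator (fun _ => (1:ℝ)) s ∂ρ := by
    apply setIntegral_congr_fun measurableSet_Ioc
    intro t ht
    simp only
    rw [setIntegral_indicator measurableSet_Iic]
    simp only [integral_const, smul_eq_mul, mul_one, MeasurableSet.univ, measureReal_restrict_apply, univ_inter]
    congr 1
    ext s; simp only [mem_inter_iff, mem_Icc, mem_Iic]
    have := ht.2; have := hx.2; grind
  rw [h1, integral_integral_swap]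
  · apply setIntegral_congr_fun measurableSet_Icc
    intro s hs
    exact inner_int a x s hs.1
  · have : (Function.uncurry fun t s : ℝ => (Iic t).indicator (fun _ => (1:ℝ)) s) =
        {p : ℝ × ℝ | p.2 ≤ p.1}.indicator (fun _ => (1:ℝ)) := by
      ext ⟨t, s⟩; simp [indicator, Function.uncurry]
    rw [this]
    exact (integrable_const _).indicator (measurableSet_le measurable_snd measurable_fst)

lemma abel (s e : ℕ → ℝ) (n : ℕ) (hs : ∀ i, i + 1 < n + 1 → s i ≤ s (i+1))
    (he : ∀ i, i ≤ n + 1 → 0 ≤ e i) (he0 : e 0 = 0) :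
    ∀ m, m ≤ n → -s m * e (m+1) ≤ ∑ i ∈ Finset.range (m+1), s i * (e i - e (i+1)) := by
  intro m
  induction m with
  | zero => intro _; simp [he0]
  | succ m ih =>
    intro hm
    rw [Finset.sum_range_succ]
    have := ih (by omega)
    have h1 := hs m (by omega)
    have h2 := he (m+1) (by omega)
    nlinarith

/-- piecewise linear interpolation -/
def interp (a h : ℝ) (c : ℝ → ℝ) (m : ℕ) (t : ℝ) : ℝ :=
  c a + ∑ i ∈ Finset.range m, ((c (a + (i+1:ℕ) * h) - c (a + (i:ℕ) * h)) / h) *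
    (h - max (a + (i+1:ℕ) * h - t) 0 + max (a + (i:ℕ) * h - t) 0)

lemma interp_spec (a h : ℝ) (hh : 0 < h) (c : ℝ → ℝ) (ε : ℝ) (n : ℕ) (t : ℝ) (hat : a ≤ t)
    (hc : ∀ s ∈ Icc a (a + n * h), |s - t| ≤ h → |c s - c t| ≤ ε) :
    ∀ m, m ≤ n → (a + m * h ≤ t → interp a h c m t = c (a + m * h)) ∧
      (t ≤ a + m * h → |interp a h c m t - c t| ≤ ε) := by
  intro m
  induction m with
  | zero =>
    intro _
    refine ⟨fun _ => by simp [interp], fun ht => ?_⟩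
    have : t = a := by simp at ht; linarith
    subst this
    have := hc t ⟨le_refl _, by have : (0:ℝ) ≤ n * h := by positivity
                                linarith⟩ (by simp; exact hh.le)
    simpa [interp] using this
  | succ m ih =>
    intro hm
    obtain ⟨ih1, ih2⟩ := ih (by omega)
    have hmn : ((m+1:ℕ):ℝ) * h ≤ n * h := by gcongr
    have hm0 : (0:ℝ) ≤ m * h := by positivity
    have hs : interp a h c (m+1) t = interp a h c m t +
      ((c (a + (m+1:ℕ) * h) - c (a + (m:ℕ) * h)) / h) *
        (h - max (a + (m+1:ℕ) * h - t) 0 + max (a + (m:ℕ) * h - t) 0) := by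
      unfold interp; rw [Finset.sum_range_succ]; ring
    have hx : a + ((m+1:ℕ):ℝ) * h = a + m * h + h := by push_cast; ring
    rw [hs]
    have hmn' : a + m * h + h ≤ a + n * h := by linarith
    rw [hx]
    constructor
    · intro ht
      rw [ih1 (by linarith), max_eq_right (by linarith), max_eq_right (by linarith)]
      field_simp; ring
    · intro ht
      by_cases h' : t ≤ a + m * h
      · rw [max_eq_left (by linarith), max_eq_left (by linarith)]
        have := ih2 h'
        ring_nf at this ⊢
        exact this
      · push Not at h'
        rw [ih1 h'.le, max_eq_left (by linarith), max_eq_right (by linarith)]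
        have hcA := hc (a + m * h) ⟨by linarith, by linarith⟩ (by rw [abs_le]; constructor <;> linarith)
        have hcB := hc (a + m * h + h) ⟨by linarith, by linarith⟩ (by rw [abs_le]; constructor <;> linarith)
        set A := c (a + m * h)
        set B := c (a + m * h + h)
        obtain ⟨l, hl⟩ : ∃ l, l = (t - (a + m * h)) / h := ⟨_, rfl⟩
        have hl0 : 0 ≤ l := by rw [hl]; apply div_nonneg <;> linarith
        have hl1 : l ≤ 1 := by rw [hl, div_le_one hh]; linarith
        have : A + (B - A) / h * (h - (a + m * h + h - t) + 0) - c t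
            = (1 - l) * (A - c t) + l * (B - c t) := by
          rw [hl]; field_simp; ring
        rw [this]
        rw [abs_le] at *
        constructor <;> nlinarith

lemma slope_mono (a b : ℝ) (c : ℝ → ℝ) (hc : ConvexOn ℝ (Icc a b) c) (y h : ℝ) (hh : 0 < h)
    (h1 : a ≤ y) (h2 : y + h + h ≤ b) : (c (y + h) - c y) / h ≤ (c (y + h + h) - c (y + h)) / h := by
  have := hc.slope_mono_adjacent (x := y) (y := y + h) (z := y + h + h) ⟨h1, by linarith⟩
    ⟨by linarith, h2⟩ (by linarith) (by linarith)
  simpa using this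

lemma core (a b : ℝ) (hab : a < b) (P N : Measure ℝ) [IsFiniteMeasure P] [IsFiniteMeasure N]
    (hP : ∀ᵐ t ∂P, t ∈ Icc a b) (hN : ∀ᵐ t ∂N, t ∈ Icc a b)
    (hm : P.real univ = N.real univ)
    (hpos : ∀ x ∈ Icc a b, ∫ s, max (x - s) 0 ∂N ≤ ∫ s, max (x - s) 0 ∂P)
    (hb : ∫ s, max (b - s) 0 ∂N = ∫ s, max (b - s) 0 ∂P)
    (c : ℝ → ℝ) (hcc : ContinuousOn c (Icc a b)) (hcv : ConvexOn ℝ (Icc a b) c)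
    (hcP : Integrable c P) (hcN : Integrable c N) :
    ∫ t, c t ∂N ≤ ∫ t, c t ∂P := by
  have hintP : ∀ x, Integrable (fun s => max (x - s) 0) P := by
    intro x
    refine Integrable.of_bound (C := |x| + |a| + |b|) (by fun_prop) ?_
    filter_upwards [hP] with s hs
    rw [Real.norm_eq_abs, abs_le]
    have := hs.1; have := hs.2
    constructor <;> grind
  have hintN : ∀ x, Integrable (fun s => max (x - s) 0) N := by
    intro x
    refine Integrable.of_bound (C := |x| + |a| + |b|) (by fun_prop) ?_
    filter_upwards [hN] with s hs
    rw [Real.norm_eq_abs, abs_le]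
    have := hs.1; have := hs.2
    constructor <;> grind
  have key : ∀ ε > 0, ∫ t, c t ∂N ≤ ∫ t, c t ∂P + ε * (2 * P.real univ) := by
    intro ε hε
    have huc := isCompact_Icc.uniformContinuousOn_of_continuous hcc
    rw [Metric.uniformContinuousOn_iff] at huc
    obtain ⟨δ, hδ, huc⟩ := huc ε hε
    obtain ⟨n, hn⟩ := exists_nat_gt ((b - a) / δ)
    obtain ⟨h, hhd⟩ : ∃ h, h = (b - a) / (n + 1 : ℕ) := ⟨_, rfl⟩
    have hn1 : (0:ℝ) < (n + 1 : ℕ) := by positivity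
    have hh : 0 < h := by rw [hhd]; exact div_pos (by linarith) hn1
    have hend : a + (n + 1 : ℕ) * h = b := by rw [hhd]; field_simp; ring
    have hhδ : h < δ := by
      rw [hhd, div_lt_iff₀ hn1]
      rw [div_lt_iff₀ hδ] at hn
      push_cast; nlinarith
    have happ : ∀ t ∈ Icc a b, |interp a h c (n+1) t - c t| ≤ ε := by
      intro t ht
      refine (interp_spec a h hh c ε (n+1) t ht.1 ?_ (n+1) le_rfl).2 (by rw [hend]; exact ht.2)
      intro s hs hst
      rw [hend] at hs
      have := huc s hs t ht (by rw [Real.dist_eq]; linarith)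
      rw [Real.dist_eq] at this
      exact this.le
    have hgrid : ∀ i : ℕ, i ≤ n + 1 → a + i * h ∈ Icc a b := by
      intro i hi
      have : (i:ℝ) * h ≤ (n+1:ℕ) * h := by gcongr
      have : 0 ≤ (i:ℝ) * h := by positivity
      constructor <;> linarith
    have gen : ∀ ρ : Measure ℝ, IsFiniteMeasure ρ → (∀ x, Integrable (fun s => max (x - s) 0) ρ) →
        Integrable (interp a h c (n+1)) ρ ∧ ∫ t, interp a h c (n+1) t ∂ρ = c a * ρ.real univ +
        ∑ i ∈ Finset.range (n+1), ((c (a + (i+1:ℕ) * h) - c (a + (i:ℕ) * h)) / h) *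
          (h * ρ.real univ - ∫ t, max (a + (i+1:ℕ) * h - t) 0 ∂ρ + ∫ t, max (a + (i:ℕ) * h - t) 0 ∂ρ) := by
      intro ρ _ hρ
      have hi : ∀ i ∈ Finset.range (n+1), Integrable (fun t => ((c (a + (i+1:ℕ) * h) - c (a + (i:ℕ) * h)) / h) *
          (h - max (a + (i+1:ℕ) * h - t) 0 + max (a + (i:ℕ) * h - t) 0)) ρ := fun i _ =>
        ((((integrable_const _).sub (hρ _)).add (hρ _)).const_mul _)
      constructor
      · exact (integrable_const _).add (integrable_finsetSum _ hi)
      · unfold interp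
        rw [integral_add (integrable_const _) (integrable_finsetSum _ hi), integral_finsetSum _ hi]
        congr 1
        · simp [mul_comm]
        · apply Finset.sum_congr rfl
          intro i _
          have hsub : Integrable (fun t => h - max (a + (i+1:ℕ) * h - t) 0) ρ :=
            (integrable_const _).sub (hρ _)
          rw [integral_const_mul, integral_add hsub (hρ _),
            integral_sub (integrable_const _) (hρ _)]
          simp [mul_comm]
    obtain ⟨iP, eP⟩ := gen P inferInstance hintP
    obtain ⟨iN, eN⟩ := gen N inferInstance hintN
    have hab := abel (fun i => (c (a + (i+1:ℕ) * h) - c (a + (i:ℕ) * h)) / h)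
      (fun i => ∫ t, max (a + (i:ℕ) * h - t) 0 ∂P - ∫ t, max (a + (i:ℕ) * h - t) 0 ∂N) n
      (by
        intro i hi
        have := slope_mono a b c hcv (a + i * h) h hh (hgrid i (by omega)).1 (by
          have := (hgrid (i+2) (by omega)).2
          push_cast at this; linarith)
        push_cast
        convert this using 4 <;> ring_nf)
      (by
        intro i hi
        exact sub_nonneg.2 (hpos _ (hgrid i hi)))
      (by
        have z : ∀ ρ : Measure ℝ, (∀ᵐ t ∂ρ, t ∈ Icc a b) → ∫ t, max (a + (0:ℕ) * h - t) 0 ∂ρ = 0 := by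
          intro ρ hρ
          apply integral_eq_zero_of_ae
          filter_upwards [hρ] with t ht
          have := ht.1
          simp; linarith
        simp only [z P hP, z N hN, sub_self]) n le_rfl
    have hLL : ∫ t, interp a h c (n+1) t ∂N ≤ ∫ t, interp a h c (n+1) t ∂P := by
      rw [← sub_nonneg, eP, eN, hm, add_sub_add_left_eq_sub, ← Finset.sum_sub_distrib]
      simp only [hend, hb, sub_self, mul_zero] at hab
      refine hab.trans (le_of_eq ?_)
      apply Finset.sum_congr rfl
      intro i _
      ring
    have h1 : ∫ t, c t ∂N ≤ ∫ t, interp a h c (n+1) t ∂N + ε * N.real univ := by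
      have : ∫ t, c t ∂N ≤ ∫ t, (interp a h c (n+1) t + ε) ∂N := by
        apply integral_mono_ae hcN (iN.add (integrable_const _))
        filter_upwards [hN] with t ht
        have := abs_le.1 (happ t ht)
        simp; linarith
      rw [integral_add iN (integrable_const _)] at this
      simpa [mul_comm] using this
    have h2 : ∫ t, interp a h c (n+1) t ∂P ≤ ∫ t, c t ∂P + ε * P.real univ := by
      have : ∫ t, interp a h c (n+1) t ∂P ≤ ∫ t, (c t + ε) ∂P := by
        apply integral_mono_ae iP (hcP.add (integrable_const _))
        filter_upwards [hP] with t ht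
        have := abs_le.1 (happ t ht)
        simp; linarith
      rw [integral_add hcP (integrable_const _)] at this
      simpa [mul_comm] using this
    rw [← hm] at h1
    linarith
  apply le_of_forall_pos_le_add
  intro η hη
  have hM : 0 ≤ P.real univ := measureReal_nonneg
  have := key (η / (2 * P.real univ + 1)) (by positivity)
  refine this.trans ?_
  gcongr
  rw [div_mul_eq_mul_div, div_le_iff₀ (by positivity)]
  nlinarith

theorem stmt12 (a b : ℝ) (hab : a < b) (μ ν : MeasureTheory.SignedMeasure ℝ)
    (hμ : ∀ E : Set ℝ, MeasurableSet E → μ E = μ (E ∩ Set.Icc a b))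
    (hν : ∀ E : Set ℝ, MeasurableSet E → ν E = ν (E ∩ Set.Icc a b))
    (H G : ℝ → ℝ)
    (hH : ∀ x : ℝ, H x = μ (Set.Icc a x))
    (hG : ∀ x : ℝ, G x = ν (Set.Icc a x))
    (hend : H b = G b) :
    (∀ c : ℝ → ℝ, ContinuousOn c (Set.Icc a b) → ConvexOn ℝ (Set.Icc a b) c →
      signedIntegral ν (Set.Icc a b) c ≤ signedIntegral μ (Set.Icc a b) c) ↔
    ((∀ x ∈ Set.Icc a b, (∫ t in a..x, G t) ≤ ∫ t in a..x, H t) ∧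
      (∫ t in a..b, H t) = ∫ t in a..b, G t) := by
  have pot : ∀ (κ : SignedMeasure ℝ) (F : ℝ → ℝ), (∀ x, F x = κ (Icc a x)) → ∀ x ∈ Icc a b,
      ∫ t in a..x, F t = signedIntegral κ (Icc a b) (fun s => max (x - s) 0) := by
    intro κ F hF x hx
    have h1 := potential a b x hx κ.toJordanDecomposition.posPart
    have h2 := potential a b x hx κ.toJordanDecomposition.negPart
    unfold signedIntegral
    rw [← h1.2, ← h2.2, ← intervalIntegral.integral_sub h1.1 h2.1]
    congr 1
    ext t
    rw [hF, jordan_apply κ _ measurableSet_Icc]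
  have hbI : b ∈ Icc a b := ⟨hab.le, le_rfl⟩
  have cvx : ∀ x : ℝ, ConvexOn ℝ (Icc a b) (fun s : ℝ => max (x - s) 0) := by
    intro x
    have : ConvexOn ℝ (Icc a b) (fun s : ℝ => x - s) :=
      (convexOn_const x (convex_Icc a b)).sub (concaveOn_id (convex_Icc a b))
    exact this.sup (convexOn_const 0 (convex_Icc a b))
  constructor
  · intro h
    have h1 : ∀ x ∈ Icc a b, (∫ t in a..x, G t) ≤ ∫ t in a..x, H t := by
      intro x hx
      rw [pot μ H hH x hx, pot ν G hG x hx]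
      exact h _ (by fun_prop) (cvx x)
    refine ⟨h1, le_antisymm ?_ (h1 b hbI)⟩
    rw [pot μ H hH b hbI, pot ν G hG b hbI]
    have h2 := h (fun s => s - b) (by fun_prop)
      ((convexOn_id (convex_Icc a b)).sub (concaveOn_const b (convex_Icc a b)))
    have e : ∀ κ : SignedMeasure ℝ, signedIntegral κ (Icc a b) (fun s => s - b) =
        - signedIntegral κ (Icc a b) (fun s => max (b - s) 0) := by
      intro κ
      have : ∀ ρ : Measure ℝ, ∫ s in Icc a b, (s - b) ∂ρ = - ∫ s in Icc a b, max (b - s) 0 ∂ρ := by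
        intro ρ
        rw [← integral_neg]
        apply setIntegral_congr_fun measurableSet_Icc
        intro s hs
        have := hs.2
        simp only
        rw [max_eq_left (by linarith)]; ring
      unfold signedIntegral
      rw [this, this]; ring
    rw [e, e] at h2
    linarith
  · rintro ⟨h1, h2⟩ c hcc hcv
    set μp := μ.toJordanDecomposition.posPart with hμp
    set μn := μ.toJordanDecomposition.negPart with hμn
    set νp := ν.toJordanDecomposition.posPart with hνp
    set νn := ν.toJordanDecomposition.negPart with hνn
    have int : ∀ (ρ : Measure ℝ) [IsFiniteMeasure ρ] (f : ℝ → ℝ), ContinuousOn f (Icc a b) →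
        Integrable f (ρ.restrict (Icc a b)) := fun ρ _ f hf => hf.integrableOn_compact isCompact_Icc
    have sp : ∀ (ρ₁ ρ₂ : Measure ℝ) [IsFiniteMeasure ρ₁] [IsFiniteMeasure ρ₂] (f : ℝ → ℝ),
        ContinuousOn f (Icc a b) → ∫ t in Icc a b, f t ∂(ρ₁ + ρ₂) =
          ∫ t in Icc a b, f t ∂ρ₁ + ∫ t in Icc a b, f t ∂ρ₂ := by
      intro ρ₁ ρ₂ _ _ f hf
      rw [Measure.restrict_add, integral_add_measure (int _ f hf) (int _ f hf)]
    have conv : ∀ f : ℝ → ℝ, ContinuousOn f (Icc a b) →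
        ∫ t in Icc a b, f t ∂(μp + νn) - ∫ t in Icc a b, f t ∂(νp + μn) =
        signedIntegral μ (Icc a b) f - signedIntegral ν (Icc a b) f := by
      intro f hf
      rw [sp _ _ f hf, sp _ _ f hf]
      unfold signedIntegral
      ring
    have hfin := core a b hab ((μp + νn).restrict (Icc a b)) ((νp + μn).restrict (Icc a b))
      (ae_restrict_mem measurableSet_Icc) (ae_restrict_mem measurableSet_Icc)
      (by
        rw [hH, hG, jordan_apply μ _ measurableSet_Icc, jordan_apply ν _ measurableSet_Icc] at hend
        simp only [MeasurableSet.univ, measureReal_restrict_apply, univ_inter]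
        rw [measureReal_add_apply, measureReal_add_apply]
        linarith)
      (by
        intro x hx
        have := conv (fun s => max (x - s) 0) (by fun_prop)
        have h3 := h1 x hx
        rw [pot μ H hH x hx, pot ν G hG x hx] at h3
        linarith)
      (by
        have := conv (fun s => max (b - s) 0) (by fun_prop)
        rw [pot μ H hH b hbI, pot ν G hG b hbI] at h2
        linarith)
      c hcc hcv (int _ c hcc) (int _ c hcc)
    have := conv c hcc
    linarith
end
end

section
/- Let U ∈ 𝒰* and suppose [L,R] = S₁ ∪ ... ∪ S_m, where S₁, ..., S_m are closed intervals with pairwise disjoint interiors listed in increasing order, U is affine on each S_j, and each S_j satisfies at least one of the following: (1) U(s) = max(0, 2s−1) for all s ∈ S_j and μ_f(E) ≤ 0 for every Borel set E ⊆ S_j; (2) there exists s* ∈ S_j with U(s*) = Ubar(s*), μ_f(S_j) ≥ 0, and for every x ∈ S_j, ∫_{min S_j}^{x} μ_f(S_j ∩ [min S_j, t]) dt ≤ μ_f(S_j)·max(0, x − s*), with equality at x = max S_j; (3) max(0, 2s−1) ≤ U(s) < Ubar(s) for all s ∈ S_j, μ_f(S_j) = 0, and ∫_{min S_j}^{x}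 μ_f(S_j ∩ [min S_j, t]) dt ≤ 0 for every x ∈ S_j, with equality at x = max S_j. Then ∫_{[L,R]} U dμ_f ≥ ∫_{[L,R]} V dμ_f for every V ∈ 𝒰*. -/
open MeasureTheory Set Filter
open scoped Classical

noncomputable section

/-- The unit cube `[0,1]^m` inside `Fin m → ℝ`. -/
def cube (m : ℕ) : Set (Fin m → ℝ) := Set.univ.pi fun _ => Set.Icc (0:ℝ) 1

/-- `w⁺(y) = ∏ y_k · f(y_k)`. -/
def wplus (f : ℝ → ℝ) {m : ℕ} (y : Fin m → ℝ) : ℝ := ∏ k, y k * f (y k)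

/-- `w⁻(y) = ∏ (1 - y_k) · f(y_k)`. -/
def wminus (f : ℝ → ℝ) {m : ℕ} (y : Fin m → ℝ) : ℝ := ∏ k, (1 - y k) * f (y k)

/-- Hypotheses on the signal density `f` with derivative `f'` on `[L,R]`. -/
structure Density (f f' : ℝ → ℝ) (L R : ℝ) : Prop where
  nonneg : ∀ s, 0 ≤ f s
  zero_outside : ∀ s ∉ Set.Icc L R, f s = 0
  pos : ∀ s ∈ Set.Icc L R, 0 < f s
  hderiv : ∀ s ∈ Set.Icc L R, HasDerivWithinAt f (f' s) (Set.Icc L R) s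
  cont_deriv : ContinuousOn f' (Set.Icc L R)
  total : (∫ s in L..R, f s) = 1
  mean : (∫ s in L..R, s * f s) = 1 / 2

/-- A mechanism is measurable with values in `[0,1]`. -/
def IsMechanism {m : ℕ} (x : ℝ → (Fin m → ℝ) → ℝ) : Prop :=
  Measurable (Function.uncurry x) ∧ ∀ s y, x s y ∈ Set.Icc (0:ℝ) 1

/-- `A(t) = ∫_{[0,1]^m} x(t,y) w⁺(y) dy`. -/
def Amap (f : ℝ → ℝ) {m : ℕ} (x : ℝ → (Fin m → ℝ) → ℝ) (t : ℝ) : ℝ :=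
  ∫ y in cube m, x t y * wplus f y

/-- `B(t) = ∫_{[0,1]^m} x(t,y) w⁻(y) dy`. -/
def Bmap (f : ℝ → ℝ) {m : ℕ} (x : ℝ → (Fin m → ℝ) → ℝ) (t : ℝ) : ℝ :=
  ∫ y in cube m, x t y * wminus f y

/-- Interim payoff `U_x(t;s) = 2^m (s A(t) - (1-s) B(t))` (with `m = n-1`). -/
def Upay (f : ℝ → ℝ) {m : ℕ} (x : ℝ → (Fin m → ℝ) → ℝ) (t s : ℝ) : ℝ :=
  2 ^ m * (s * Amap f x t - (1 - s) * Bmap f x t)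

/-- Feasibility: mechanism + participation + incentive compatibility on `[L,R]`. -/
def Feasible (f : ℝ → ℝ) (L R : ℝ) {m : ℕ} (x : ℝ → (Fin m → ℝ) → ℝ) : Prop :=
  IsMechanism x ∧ (∀ s ∈ Set.Icc L R, 0 ≤ Upay f x s s) ∧
    (∀ s ∈ Set.Icc L R, ∀ t ∈ Set.Icc L R, Upay f x t s ≤ Upay f x s s)

/-- The designer's value `V(x)`. -/
def Value (f : ℝ → ℝ) (L R : ℝ) {m : ℕ} (x : ℝ → (Fin m → ℝ) → ℝ) : ℝ :=
  2 ^ m * ∫ s in L..R, (s * Amap f x s + (1 - s) * Bmap f x s) * f s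

/-- The first-best utility `Ubar`. -/
def Ubar (f : ℝ → ℝ) (m : ℕ) (s : ℝ) : ℝ :=
  2 ^ m * ∫ y in cube m, max (s * wplus f y - (1 - s) * wminus f y) 0

/-- The objective density `g(s) = -3(1-2s) f(s) - 2 s (1-s) f'(s)`. -/
def gfun (f f' : ℝ → ℝ) (s : ℝ) : ℝ := -3 * (1 - 2 * s) * f s - 2 * s * (1 - s) * f' s

/-- The signed measure `μ_f` evaluated at a Borel set `E ⊆ [L,R]`. -/
def muF (f f' : ℝ → ℝ) (L R : ℝ) (E : Set ℝ) : ℝ :=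
  (∫ s in E, gfun f f' s) -
    (if L ∈ E then 2 * L * (1 - L) * f L else 0) +
    (if R ∈ E then 2 * R * (1 - R) * f R else 0)

/-- The integral `∫_{[L,R]} W dμ_f`. -/
def Jfun (f f' : ℝ → ℝ) (L R : ℝ) (W : ℝ → ℝ) : ℝ :=
  (∫ s in L..R, gfun f f' s * W s) + 2 * R * (1 - R) * f R * W R -
    2 * L * (1 - L) * f L * W L

/-- The set `𝒰*` of monotone convex functions between `max(0, 2s-1)` and `Ubar`. -/
def InUstar (f : ℝ → ℝ) (m : ℕ) (U : ℝ → ℝ) : Prop :=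
  MonotoneOn U (Set.Icc (0:ℝ) 1) ∧ ConvexOn ℝ (Set.Icc (0:ℝ) 1) U ∧
    ∀ s ∈ Set.Icc (0:ℝ) 1, max 0 (2 * s - 1) ≤ U s ∧ U s ≤ Ubar f m s


theorem abel_aux (k G : ℕ → ℝ) (N : ℕ) (hk : ∀ i, i + 1 < N → k i ≤ k (i + 1))
    (hG0 : G 0 = 0) (hG : ∀ i, i ≤ N → G i ≤ 0) :
    ∀ n, n < N → k n * G (n + 1) ≤ ∑ i ∈ Finset.range (n + 1), k i * (G (i + 1) - G i) := by
  intro n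
  induction n with
  | zero => intro _; simp [hG0]
  | succ n ih =>
    intro hn
    rw [Finset.sum_range_succ]
    have h1 := ih (by omega)
    have h2 := hk n hn
    have h3 := hG (n + 1) (by omega)
    nlinarith

theorem interp_aux (a b h K : ℝ) (N : ℕ) (hh : 0 < h) (hK : 0 ≤ K) (hb : a + N * h = b)
    (D : ℝ → ℝ)
    (hLip : ∀ s ∈ Icc a b, ∀ t ∈ Icc a b, |D s - D t| ≤ K * |s - t|)
    (s : ℝ) (hs : a ≤ s) :
    ∀ n, n ≤ N →
      ((a + n * h ≤ s → ∑ i ∈ Finset.range n, (D (a + (i + 1 : ℕ) * h) - D (a + i * h)) / h *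
        (max (a + (i + 1 : ℕ) * h - s) 0 - max (a + i * h - s) 0) = 0) ∧
      (s ≤ a + n * h → |∑ i ∈ Finset.range n, (D (a + (i + 1 : ℕ) * h) - D (a + i * h)) / h *
        (max (a + (i + 1 : ℕ) * h - s) 0 - max (a + i * h - s) 0) - (D (a + n * h) - D s)|
          ≤ 2 * K * h)) := by
  intro n
  induction n with
  | zero =>
    intro _
    refine ⟨fun _ => by simp, fun h1 => ?_⟩
    have : s = a := by simp at h1; linarith
    subst this
    simp; positivity
  | succ n ih =>
    intro hn
    obtain ⟨ih1, ih2⟩ := ih (by omega)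
    rw [Finset.sum_range_succ]
    have hx : a + (n + 1 : ℕ) * h = a + n * h + h := by push_cast; ring
    have hle : a + (n + 1 : ℕ) * h ≤ b := by
      rw [← hb]; gcongr
    have hge : a ≤ a + n * h := by
      have : 0 ≤ (n : ℝ) * h := by positivity
      linarith
    set x := a + n * h with hxdef
    rw [hx] at hle ⊢
    constructor
    · intro h1
      rw [ih1 (by linarith), max_eq_right (by linarith), max_eq_right (by linarith)]
      simp
    · intro h1
      rcases le_total s x with h2 | h2
      · rw [max_eq_left (by linarith), max_eq_left (by linarith)]
        have h3 := ih2 h2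
        have : (D (x + h) - D x) / h * (x + h - s - (x - s)) = D (x + h) - D x := by
          field_simp; ring
        rw [this]
        convert h3 using 2
        ring
      · rw [ih1 h2, max_eq_left (by linarith), max_eq_right (by linarith)]
        have h3 := hLip (x + h) ⟨by linarith, hle⟩ x ⟨hge, by linarith⟩
        have h4 := hLip (x + h) ⟨by linarith, hle⟩ s ⟨hs, by linarith⟩
        have e1 : |x + h - x| = h := by rw [add_sub_cancel_left, abs_of_pos hh]
        have e2 : |x + h - s| ≤ h := by rw [abs_le]; constructor <;> linarith
        rw [e1] at h3
        have h5 : |(D (x + h) - D x) / h * (x + h - s)| ≤ K * h := by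
          rw [abs_mul, abs_div, abs_of_pos hh]
          have : |D (x + h) - D x| / h ≤ K := by rw [div_le_iff₀ hh]; exact h3
          gcongr
        have h6 : |D (x + h) - D s| ≤ K * h := h4.trans (by gcongr)
        rw [abs_le] at *
        constructor <;> linarith

theorem abstract_core (a b K C : ℝ) (hab : a < b) (hK : 0 ≤ K) (hC : 0 ≤ C)
    (Φ : (ℝ → ℝ) → ℝ)
    (hadd : ∀ V W : ℝ → ℝ, ContinuousOn V (Icc a b) → ContinuousOn W (Icc a b) →
      Φ (fun s => V s + W s) = Φ V + Φ W)
    (hsmul : ∀ (c : ℝ) (W : ℝ → ℝ), Φ (fun s => c * W s) = c * Φ W)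
    (hbound : ∀ (E : ℝ → ℝ) (ε : ℝ), ContinuousOn E (Icc a b) →
      (∀ s ∈ Icc a b, |E s| ≤ ε) → |Φ E| ≤ C * ε)
    (h1 : Φ (fun _ => 1) = 0)
    (hx : ∀ x ∈ Icc a b, Φ (fun s => max (x - s) 0) ≤ 0)
    (hxb : Φ (fun s => max (b - s) 0) = 0)
    (D : ℝ → ℝ) (hD : ConvexOn ℝ (Icc a b) D)
    (hLip : ∀ s ∈ Icc a b, ∀ t ∈ Icc a b, |D s - D t| ≤ K * |s - t|) : Φ D ≤ 0 := by
  have hDc : ContinuousOn D (Icc a b) := by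
    have : LipschitzOnWith ⟨K, hK⟩ D (Icc a b) :=
      LipschitzOnWith.of_dist_le_mul (fun s hs t ht => hLip s hs t ht)
    exact this.continuousOn
  have hxa : Φ (fun s => max (a - s) 0) = 0 := by
    have := hbound (fun s => max (a - s) 0) 0 (by fun_prop) (by
      intro s hs
      rw [max_eq_right (by linarith [hs.1])]; simp)
    simpa using this
  have main : ∀ N : ℕ, Φ D ≤ C * (2 * K * ((b - a) / ((N : ℝ) + 1))) := by
    intro N
    set h := (b - a) / ((N : ℝ) + 1) with hhdef
    have hN : (0:ℝ) < (N:ℝ) + 1 := by positivity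
    have hh : 0 < h := div_pos (by linarith) hN
    have hb : a + ((N + 1 : ℕ) : ℝ) * h = b := by
      rw [hhdef]; push_cast; field_simp; ring
    have hmem : ∀ i : ℕ, i ≤ N + 1 → a + (i:ℝ) * h ∈ Icc a b := by
      intro i hi
      constructor
      · have : 0 ≤ (i:ℝ) * h := by positivity
        linarith
      · rw [← hb]; gcongr
    let k : ℕ → ℝ := fun i => (D (a + (i + 1 : ℕ) * h) - D (a + i * h)) / h
    let Hg : ℕ → ℝ → ℝ := fun i s => max (a + i * h - s) 0
    let T : ℕ → ℝ → ℝ := fun n s => ∑ i ∈ Finset.range n, k i * (Hg (i + 1) s - Hg i s)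
    have hHc : ∀ i, Continuous (Hg i) := by intro i; simp only [Hg]; fun_prop
    have hTc : ∀ n, Continuous (T n) := by
      intro n
      simp only [T]
      exact continuous_finsetSum _ fun i _ => continuous_const.mul ((hHc _).sub (hHc _))
    have hT : ∀ n, Φ (T n) = ∑ i ∈ Finset.range n, k i * (Φ (Hg (i + 1)) - Φ (Hg i)) := by
      intro n
      induction n with
      | zero =>
        have := hsmul 0 (T 0)
        have e : (fun s => 0 * T 0 s) = T 0 := by funext s; simp [T]
        rw [e] at this
        rw [this]; simp
      | succ n ih =>
        have e : T (n + 1) = fun s => T n s + k n * (Hg (n + 1) s + (-1) * Hg n s) := by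
          funext s; simp only [T]; rw [Finset.sum_range_succ]; ring
        rw [e, hadd _ _ (hTc n).continuousOn (by
            exact (continuous_const.mul ((hHc _).add (continuous_const.mul (hHc _)))).continuousOn),
          hsmul, hadd (Hg (n + 1)) (fun s => -1 * Hg n s) (hHc _).continuousOn
            (continuous_const.mul (hHc _)).continuousOn,
          hsmul, Finset.sum_range_succ, ih]
        ring
    have hkmono : ∀ i, i + 1 < N + 1 → k i ≤ k (i + 1) := by
      intro i hi
      have h2 := hD.slope_mono_adjacent (x := a + i * h) (y := a + (i + 1 : ℕ) * h)
        (z := a + (i + 1 + 1 : ℕ) * h) (hmem i (by omega)) (hmem (i + 2) (by omega))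
        (by push_cast; nlinarith) (by push_cast; nlinarith)
      have e1 : a + (i + 1 : ℕ) * h - (a + i * h) = h := by push_cast; ring
      have e2 : a + (i + 1 + 1 : ℕ) * h - (a + (i + 1 : ℕ) * h) = h := by push_cast; ring
      rw [e1, e2] at h2
      exact h2
    have hG0 : Φ (Hg 0) = 0 := by
      have : Hg 0 = fun s => max (a - s) 0 := by funext s; simp [Hg]
      rw [this, hxa]
    have hGN : Φ (Hg (N + 1)) = 0 := by
      have : Hg (N + 1) = fun s => max (b - s) 0 := by funext s; simp only [Hg]; rw [hb]
      rw [this, hxb]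
    have habel := abel_aux k (fun i => Φ (Hg i)) (N + 1) hkmono hG0
      (fun i hi => hx _ (hmem i hi)) N (by omega)
    simp only [hGN, mul_zero] at habel
    rw [← hT] at habel
    -- remainder
    let E : ℝ → ℝ := fun s => T (N + 1) s + ((-1) * (D b * 1) + D s)
    have hEc : ContinuousOn E (Icc a b) :=
      (hTc _).continuousOn.add (continuousOn_const.add hDc)
    have hEb : |Φ E| ≤ C * (2 * K * h) := by
      apply hbound E _ hEc
      intro s hs
      have := (interp_aux a b h K (N + 1) hh hK hb D hLip s hs.1 (N + 1) le_rfl).2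
        (by rw [hb]; exact hs.2)
      rw [hb] at this
      convert this using 2
      simp only [E, T, k, Hg]
      ring
    have hE : Φ E = Φ (T (N + 1)) + Φ D := by
      simp only [E]
      rw [hadd (T (N + 1)) (fun s => -1 * (D b * 1) + D s) (hTc _).continuousOn
          (continuousOn_const.add hDc),
        hadd (fun _ => -1 * (D b * 1)) D continuousOn_const hDc, hsmul (-1) (fun _ => D b * 1), hsmul (D b) (fun _ => 1), h1]
      ring
    have := (abs_le.1 hEb).2
    linarith
  have hlim : Tendsto (fun N : ℕ => C * (2 * K * ((b - a) / ((N : ℝ) + 1)))) atTop (nhds 0) := by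
    have := (tendsto_one_div_add_atTop_nhds_zero_nat (𝕜 := ℝ)).const_mul (C * (2 * K * (b - a)))
    rw [mul_zero] at this
    refine this.congr fun N => ?_
    ring
  exact ge_of_tendsto' hlim main

theorem hinge_int (g : ℝ → ℝ) (hg : Continuous g) (a b x : ℝ) (hx : x ∈ Icc a b) :
    ∫ s in a..b, g s * max (x - s) 0 = ∫ t in a..x, ∫ s in a..t, g s := by
  have hc : Continuous fun s => g s * max (x - s) 0 := by fun_prop
  rw [← intervalIntegral.integral_add_adjacent_intervals (hc.intervalIntegrable a x)
    (hc.intervalIntegrable x b)]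
  have e2 : ∫ s in x..b, g s * max (x - s) 0 = 0 := by
    rw [intervalIntegral.integral_congr (g := fun _ => (0:ℝ))]
    · simp
    · intro s hs
      rw [uIcc_of_le hx.2] at hs
      simp only
      rw [max_eq_right (by linarith [hs.1]), mul_zero]
  have e1 : ∫ s in a..x, g s * max (x - s) 0 = ∫ s in a..x, (x - s) * g s := by
    apply intervalIntegral.integral_congr
    intro s hs
    rw [uIcc_of_le hx.1] at hs
    simp only
    rw [max_eq_left (by linarith [hs.2]), mul_comm]
  rw [e1, e2, add_zero]
  have := intervalIntegral.integral_mul_deriv_eq_deriv_mul (a := a) (b := x)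
    (u := fun s => x - s) (u' := fun _ => -1) (v := fun t => ∫ s in a..t, g s) (v' := g)
    (fun s _ => by simpa using (hasDerivAt_id s).const_sub x)
    (fun s _ => intervalIntegral.integral_hasDerivAt_right (hg.intervalIntegrable _ _)
      (hg.stronglyMeasurableAtFilter _ _) hg.continuousAt)
    (by simp) (hg.intervalIntegrable _ _)
  rw [this]
  simp

theorem core_s13 (g : ℝ → ℝ) (hg : Continuous g) (a b cL cR M ss K : ℝ) (hab : a < b) (hK : 0 ≤ K)
    (hss : ss ∈ Icc a b) (hM : M = (∫ s in a..b, g s) + cL + cR)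
    (hle : ∀ x ∈ Icc a b, ∫ t in a..x, ((∫ s in a..t, g s) + cL) ≤ M * max 0 (x - ss))
    (heq : ∫ t in a..b, ((∫ s in a..t, g s) + cL) = M * max 0 (b - ss))
    (D : ℝ → ℝ) (hD : ConvexOn ℝ (Icc a b) D)
    (hLip : ∀ s ∈ Icc a b, ∀ t ∈ Icc a b, |D s - D t| ≤ K * |s - t|)
    (hDs : M * D ss ≤ 0) :
    (∫ s in a..b, g s * D s) + cL * D a + cR * D b ≤ 0 := by
  have hint : ∀ W : ℝ → ℝ, ContinuousOn W (Icc a b) →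
      IntervalIntegrable (fun s => g s * W s) volume a b := by
    intro W hW
    apply ContinuousOn.intervalIntegrable
    rw [uIcc_of_le hab.le]
    exact hg.continuousOn.mul hW
  have hprim : Continuous fun t => ∫ s in a..t, g s :=
    intervalIntegral.continuous_primitive (fun _ _ => hg.intervalIntegrable _ _) a
  have hhinge : ∀ x ∈ Icc a b, (∫ s in a..b, g s * max (x - s) 0) + cL * max (x - a) 0
      + cR * max (x - b) 0 - M * max (x - ss) 0
      = (∫ t in a..x, ((∫ s in a..t, g s) + cL)) - M * max 0 (x - ss) := by
    intro x hx
    rw [hinge_int g hg a b x hx, max_eq_left (by linarith [hx.1] : (0:ℝ) ≤ x - a),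
      max_eq_right (by linarith [hx.2] : x - b ≤ (0:ℝ)), max_comm (x - ss) 0,
      intervalIntegral.integral_add (hprim.intervalIntegrable _ _) (by simp)]
    simp
    ring
  have key := abstract_core a b K ((∫ s in a..b, |g s|) + |cL| + |cR| + |M|) hab hK
    (by have := intervalIntegral.integral_nonneg hab.le (fun s _ => abs_nonneg (g s)) (μ := volume)
        positivity)
    (fun W => (∫ s in a..b, g s * W s) + cL * W a + cR * W b - M * W ss)
    (by
      intro V W hV hW
      have : ∫ s in a..b, g s * (V s + W s) = (∫ s in a..b, g s * V s) + ∫ s in a..b, g s * W s := by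
        rw [← intervalIntegral.integral_add (hint V hV) (hint W hW)]
        congr 1; funext s; ring
      simp only [this]
      ring)
    (by
      intro c W
      have : ∫ s in a..b, g s * (c * W s) = c * ∫ s in a..b, g s * W s := by
        rw [← intervalIntegral.integral_const_mul]
        congr 1; funext s; ring
      simp only [this]
      ring)
    (by
      intro E ε hE hEε
      have i1 : |∫ s in a..b, g s * E s| ≤ (∫ s in a..b, |g s|) * ε := by
        calc |∫ s in a..b, g s * E s| ≤ ∫ s in a..b, |g s * E s| :=
              intervalIntegral.abs_integral_le_integral_abs hab.le
          _ ≤ ∫ s in a..b, |g s| * ε := by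
              apply intervalIntegral.integral_mono_on hab.le (hint E hE).abs
                ((hg.abs.mul continuous_const).intervalIntegrable _ _)
              intro s hs
              rw [abs_mul]
              exact mul_le_mul_of_nonneg_left (hEε s hs) (abs_nonneg _)
          _ = _ := by rw [intervalIntegral.integral_mul_const]
      have t : ∀ c s, s ∈ Icc a b → |c * E s| ≤ |c| * ε := by
        intro c s hs
        rw [abs_mul]
        exact mul_le_mul_of_nonneg_left (hEε s hs) (abs_nonneg _)
      have i2 := t cL a (left_mem_Icc.2 hab.le)
      have i3 := t cR b (right_mem_Icc.2 hab.le)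
      have i4 := t M ss hss
      simp only [add_mul]
      rw [abs_le] at *
      constructor <;> linarith)
    (by simp [hM])
    (by
      intro x hx
      simp only
      rw [hhinge x hx]
      linarith [hle x hx])
    (by
      simp only
      rw [hhinge b (right_mem_Icc.2 hab.le)]
      linarith)
    D hD hLip
  linarith

theorem case_one (g : ℝ → ℝ) (hg : Continuous g) (a b cL cR : ℝ) (hab : a < b)
    (hcL : cL ≤ 0) (hcR : cR ≤ 0)
    (hE : ∀ E : Set ℝ, MeasurableSet E → E ⊆ Ioo a b → ∫ s in E, g s ≤ 0)
    (D : ℝ → ℝ) (hD : ∀ s ∈ Icc a b, 0 ≤ D s) :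
    (∫ s in a..b, g s * D s) + cL * D a + cR * D b ≤ 0 := by
  have h1 : 0 ≤ᵐ[volume.restrict (Ioo a b)] (fun s => - g s) := by
    apply ae_nonneg_restrict_of_forall_setIntegral_nonneg_inter
    · exact (hg.neg.integrableOn_Icc).mono_set Ioo_subset_Icc_self
    · intro s hs _
      rw [integral_neg]
      linarith [hE (s ∩ Ioo a b) (hs.inter measurableSet_Ioo) inter_subset_right]
  have h2 : ∫ s in a..b, g s * D s ≤ 0 := by
    rw [intervalIntegral.integral_of_le hab.le, integral_Ioc_eq_integral_Ioo]
    apply integral_nonpos_of_ae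
    filter_upwards [h1, ae_restrict_mem measurableSet_Ioo] with s h1 h2
    have := hD s (Ioo_subset_Icc_self h2)
    simp at h1 ⊢
    nlinarith
  have := hD a (left_mem_Icc.2 hab.le)
  have := hD b (right_mem_Icc.2 hab.le)
  nlinarith

theorem Ubar_one (f f' : ℝ → ℝ) (L R : ℝ) (hL : 0 ≤ L) (hLR : L < R) (hR : R ≤ 1)
    (hf : Density f f' L R) (m : ℕ) : Ubar f m 1 = 1 := by
  unfold Ubar
  have hms : MeasurableSet (cube m) := MeasurableSet.univ_pi fun _ => measurableSet_Icc
  have h1 : ∫ y in cube m, max (1 * wplus f y - (1 - 1) * wminus f y) 0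
      = ∫ y in cube m, ∏ k, (y k * f (y k)) := by
    apply setIntegral_congr_fun hms
    intro y hy
    simp only [wplus, sub_self, zero_mul, one_mul, sub_zero]
    apply max_eq_left
    apply Finset.prod_nonneg
    intro i _
    exact mul_nonneg (hy i (mem_univ i)).1 (hf.nonneg _)
  have h2 : ∫ y in Icc (0:ℝ) 1, y * f y = 1 / 2 := by
    rw [← hf.mean, intervalIntegral.integral_of_le hLR.le, ← integral_Icc_eq_integral_Ioc]
    apply setIntegral_eq_of_subset_of_forall_sdiff_eq_zero measurableSet_Icc
    · exact Icc_subset_Icc hL hR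
    · intro x hx
      rw [hf.zero_outside x hx.2, mul_zero]
  rw [h1, cube, volume_pi, Measure.restrict_pi_pi,
    integral_fintype_prod_eq_pow (fun y : ℝ => y * f y), h2]
  simp

theorem ustar_lip (f : ℝ → ℝ) (m : ℕ) (h1 : Ubar f m 1 = 1) (V : ℝ → ℝ) (hV : InUstar f m V) :
    ∀ s ∈ Icc (0:ℝ) 1, ∀ t ∈ Icc (0:ℝ) 1, |V s - V t| ≤ 2 * |s - t| := by
  obtain ⟨hm, hc, hb⟩ := hV
  have hV1 : V 1 ≤ 1 := by have := (hb 1 (by simp)).2; linarith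
  have hlow : ∀ s ∈ Icc (0:ℝ) 1, 2 * s - 1 ≤ V s := fun s hs =>
    (le_max_right _ _).trans (hb s hs).1
  have key : ∀ s ∈ Icc (0:ℝ) 1, ∀ t ∈ Icc (0:ℝ) 1, s ≤ t → V t - V s ≤ 2 * (t - s) := by
    intro s hs t ht hst
    rcases hst.eq_or_lt with h | h
    · subst h; simp
    rcases ht.2.eq_or_lt with h' | h'
    · subst h'
      linarith [hlow s hs]
    have h2 := hc.slope_mono_adjacent hs (right_mem_Icc.2 zero_le_one) h h'
    have h3 : (V 1 - V t) / (1 - t) ≤ 2 := by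
      rw [div_le_iff₀ (by linarith)]
      linarith [hlow t ht]
    have h4 := h2.trans h3
    rwa [div_le_iff₀ (by linarith)] at h4
  intro s hs t ht
  rcases le_total s t with h | h
  · rw [abs_sub_comm, abs_sub_comm s t, abs_of_nonneg (sub_nonneg.2 (hm hs ht h)),
      abs_of_nonneg (sub_nonneg.2 h)]
    exact key s hs t ht h
  · rw [abs_of_nonneg (sub_nonneg.2 (hm ht hs h)), abs_of_nonneg (sub_nonneg.2 h)]
    exact key t ht s hs h

theorem piece (n : ℕ) (L R : ℝ) (hL : 0 ≤ L) (hLR : L < R) (hR : R ≤ 1)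
    (f f' : ℝ → ℝ) (hf : Density f f' L R)
    (g : ℝ → ℝ) (hg : Continuous g) (hgf : ∀ s ∈ Icc L R, g s = gfun f f' s)
    (U V : ℝ → ℝ) (hU : InUstar f (n - 1) U) (hV : InUstar f (n - 1) V)
    (a b : ℝ) (hab : a < b) (haL : L ≤ a) (hbR : b ≤ R)
    (haff : ∃ α β : ℝ, ∀ s ∈ Set.Icc a b, U s = α * s + β)
    (hcases :
      ((∀ s ∈ Set.Icc a b, U s = max 0 (2 * s - 1)) ∧
        (∀ E : Set ℝ, MeasurableSet E → E ⊆ Set.Icc a b →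
          muF f f' L R E ≤ 0)) ∨
      (∃ sstar ∈ Set.Icc a b,
        U sstar = Ubar f (n - 1) sstar ∧
        0 ≤ muF f f' L R (Set.Icc a b) ∧
        (∀ xx ∈ Set.Icc a b,
          (∫ t in a..xx,
            muF f f' L R (Set.Icc a b ∩ Set.Icc a t)) ≤
            muF f f' L R (Set.Icc a b) * max 0 (xx - sstar)) ∧
        (∫ t in a..b,
          muF f f' L R (Set.Icc a b ∩ Set.Icc a t)) =
          muF f f' L R (Set.Icc a b) * max 0 (b - sstar)) ∨
      ((∀ s ∈ Set.Icc a b,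
          max 0 (2 * s - 1) ≤ U s ∧ U s < Ubar f (n - 1) s) ∧
        muF f f' L R (Set.Icc a b) = 0 ∧
        (∀ xx ∈ Set.Icc a b,
          (∫ t in a..xx,
            muF f f' L R (Set.Icc a b ∩ Set.Icc a t)) ≤ 0) ∧
        (∫ t in a..b,
          muF f f' L R (Set.Icc a b ∩ Set.Icc a t)) = 0)) :
    (∫ s in a..b, g s * (V s - U s)) + (if a = L then -(2 * L * (1 - L) * f L) else 0) * (V a - U a)
      + (if b = R then 2 * R * (1 - R) * f R else 0) * (V b - U b) ≤ 0 := by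
  have hsub : Icc a b ⊆ Icc (0:ℝ) 1 := Icc_subset_Icc (hL.trans haL) (hbR.trans hR)
  have hsubLR : Icc a b ⊆ Icc L R := Icc_subset_Icc haL hbR
  have hU1 := Ubar_one f f' L R hL hLR hR hf (n - 1)
  have lipU := ustar_lip f (n - 1) hU1 U hU
  have lipV := ustar_lip f (n - 1) hU1 V hV
  have lipD : ∀ s ∈ Icc a b, ∀ t ∈ Icc a b,
      |(fun s => V s - U s) s - (fun s => V s - U s) t| ≤ 4 * |s - t| := by
    intro s hs t ht
    have h1 := lipU s (hsub hs) t (hsub ht)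
    have h2 := lipV s (hsub hs) t (hsub ht)
    rw [abs_le] at *
    constructor <;> simp only <;> linarith
  have hconv : ConvexOn ℝ (Icc a b) (fun s => V s - U s) := by
    obtain ⟨α, β, h⟩ := haff
    refine ⟨convex_Icc a b, ?_⟩
    intro x hx y hy p q hp hq hpq
    have h1 := hV.2.1.2 (hsub hx) (hsub hy) hp hq hpq
    have h2 := convex_Icc a b hx hy hp hq hpq
    simp only [smul_eq_mul] at *
    rw [h x hx, h y hy, h _ h2]
    have : q = 1 - p := by linarith
    subst this
    linarith
  have mem_L : L ∈ Icc a b ↔ a = L :=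
    ⟨fun h => le_antisymm h.1 haL, fun h => by rw [h] at hab ⊢; exact ⟨le_rfl, hab.le⟩⟩
  have mem_R : R ∈ Icc a b ↔ b = R :=
    ⟨fun h => le_antisymm hbR h.2, fun h => by rw [h] at hab ⊢; exact ⟨hab.le, le_rfl⟩⟩
  have hgE : ∀ E : Set ℝ, MeasurableSet E → E ⊆ Icc L R →
      ∫ s in E, gfun f f' s = ∫ s in E, g s := by
    intro E hE hEs
    exact setIntegral_congr_fun hE fun s hs => (hgf s (hEs hs)).symm
  have mu_S : muF f f' L R (Icc a b) = (∫ s in a..b, g s)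
      + (if a = L then -(2 * L * (1 - L) * f L) else 0)
      + (if b = R then 2 * R * (1 - R) * f R else 0) := by
    unfold muF
    rw [hgE _ measurableSet_Icc hsubLR, intervalIntegral.integral_of_le hab.le,
      ← integral_Icc_eq_integral_Ioc]
    simp only [mem_L, mem_R]
    split_ifs <;> ring
  have mu_t : ∀ t ∈ Ioo a b, muF f f' L R (Icc a b ∩ Icc a t) = (∫ s in a..t, g s)
      + (if a = L then -(2 * L * (1 - L) * f L) else 0) := by
    intro t ht
    have e : Icc a b ∩ Icc a t = Icc a t :=
      inter_eq_right.2 (Icc_subset_Icc le_rfl ht.2.le)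
    have m1 : L ∈ Icc a t ↔ a = L :=
      ⟨fun h => le_antisymm h.1 haL, fun h => by rw [← h]; exact ⟨le_rfl, ht.1.le⟩⟩
    have m2 : R ∉ Icc a t := fun h => by linarith [h.2, ht.2]
    unfold muF
    rw [e, hgE _ measurableSet_Icc (Icc_subset_Icc haL (ht.2.le.trans hbR)),
      intervalIntegral.integral_of_le ht.1.le, ← integral_Icc_eq_integral_Ioc]
    simp only [m1, m2, if_false]
    split_ifs <;> ring
  have mu_int : ∀ x ∈ Icc a b, ∫ t in a..x, muF f f' L R (Icc a b ∩ Icc a t)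
      = ∫ t in a..x, ((∫ s in a..t, g s)
      + (if a = L then -(2 * L * (1 - L) * f L) else 0)) := by
    intro x hx
    rw [intervalIntegral.integral_of_le hx.1, intervalIntegral.integral_of_le hx.1,
      integral_Ioc_eq_integral_Ioo, integral_Ioc_eq_integral_Ioo]
    exact setIntegral_congr_fun measurableSet_Ioo fun t ht => mu_t t ⟨ht.1, ht.2.trans_le hx.2⟩
  rcases hcases with ⟨h1, h2⟩ | ⟨ss, hss, h1, h2, h3, h4⟩ | ⟨h1, h2, h3, h4⟩
  · apply case_one g hg a b _ _ hab _ _ _ (fun s => V s - U s)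
    · intro s hs
      have := (hV.2.2 s (hsub hs)).1
      rw [h1 s hs]; linarith
    · split_ifs with h
      · have := hf.nonneg L
        have : 0 ≤ 2 * L * (1 - L) * f L := by
          have : 0 ≤ 1 - L := by linarith
          positivity
        linarith
      · exact le_rfl
    · split_ifs with h
      · have := h2 {R} (measurableSet_singleton R) (by
          rw [singleton_subset_iff]; exact mem_R.2 h)
        unfold muF at this
        simpa [hLR.ne] using this
      · exact le_rfl
    · intro E hE hEs
      have := h2 E hE (hEs.trans Ioo_subset_Icc_self)
      unfold muF at this
      have m1 : L ∉ E := fun h => by linarith [(hEs h).1]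
      have m2 : R ∉ E := fun h => by linarith [(hEs h).2]
      rw [hgE E hE (hEs.trans (Ioo_subset_Icc_self.trans hsubLR))] at this
      simpa [m1, m2] using this
  · refine core_s13 g hg a b _ _ _ ss 4 hab (by norm_num) hss mu_S ?_ ?_ (fun s => V s - U s)
      hconv lipD ?_
    · intro x hx
      rw [← mu_int x hx]; exact h3 x hx
    · rw [← mu_int b (right_mem_Icc.2 hab.le)]; exact h4
    · apply mul_nonpos_of_nonneg_of_nonpos h2
      have := (hV.2.2 ss (hsub hss)).2
      linarith
  · refine core_s13 g hg a b _ _ _ a 4 hab (by norm_num) (left_mem_Icc.2 hab.le) mu_S ?_ ?_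
      (fun s => V s - U s) hconv lipD ?_
    · intro x hx
      rw [← mu_int x hx, h2, zero_mul]; exact h3 x hx
    · rw [← mu_int b (right_mem_Icc.2 hab.le), h2, zero_mul]; exact h4
    · rw [h2, zero_mul]

theorem stmt13 (n : ℕ) (hn : 2 ≤ n) (L R : ℝ) (hL : 0 ≤ L) (hLR : L < R) (hR : R ≤ 1)
    (f f' : ℝ → ℝ) (hf : Density f f' L R)
    (U : ℝ → ℝ) (hU : InUstar f (n - 1) U)
    (m : ℕ) (hm : 1 ≤ m) (p : ℕ → ℝ)
    (hp0 : p 0 = L) (hpm : p m = R) (hmono : ∀ j < m, p j ≤ p (j + 1))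
    (haffine : ∀ j < m, ∃ α β : ℝ, ∀ s ∈ Set.Icc (p j) (p (j + 1)), U s = α * s + β)
    (hcases : ∀ j < m,
      -- Case (1)
      ((∀ s ∈ Set.Icc (p j) (p (j + 1)), U s = max 0 (2 * s - 1)) ∧
        (∀ E : Set ℝ, MeasurableSet E → E ⊆ Set.Icc (p j) (p (j + 1)) →
          muF f f' L R E ≤ 0)) ∨
      -- Case (2)
      (∃ sstar ∈ Set.Icc (p j) (p (j + 1)),
        U sstar = Ubar f (n - 1) sstar ∧
        0 ≤ muF f f' L R (Set.Icc (p j) (p (j + 1))) ∧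
        (∀ xx ∈ Set.Icc (p j) (p (j + 1)),
          (∫ t in (p j)..xx,
            muF f f' L R (Set.Icc (p j) (p (j + 1)) ∩ Set.Icc (p j) t)) ≤
            muF f f' L R (Set.Icc (p j) (p (j + 1))) * max 0 (xx - sstar)) ∧
        (∫ t in (p j)..(p (j + 1)),
          muF f f' L R (Set.Icc (p j) (p (j + 1)) ∩ Set.Icc (p j) t)) =
          muF f f' L R (Set.Icc (p j) (p (j + 1))) * max 0 (p (j + 1) - sstar)) ∨
      -- Case (3)
      ((∀ s ∈ Set.Icc (p j) (p (j + 1)),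
          max 0 (2 * s - 1) ≤ U s ∧ U s < Ubar f (n - 1) s) ∧
        muF f f' L R (Set.Icc (p j) (p (j + 1))) = 0 ∧
        (∀ xx ∈ Set.Icc (p j) (p (j + 1)),
          (∫ t in (p j)..xx,
            muF f f' L R (Set.Icc (p j) (p (j + 1)) ∩ Set.Icc (p j) t)) ≤ 0) ∧
        (∫ t in (p j)..(p (j + 1)),
          muF f f' L R (Set.Icc (p j) (p (j + 1)) ∩ Set.Icc (p j) t)) = 0)) :
    ∀ Vfun : ℝ → ℝ, InUstar f (n - 1) Vfun →
      Jfun f f' L R Vfun ≤ Jfun f f' L R U := by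
  intro V hV
  have hfc : ContinuousOn f (Icc L R) := fun s hs => (hf.hderiv s hs).continuousWithinAt
  have hgc : ContinuousOn (gfun f f') (Icc L R) := by
    unfold gfun
    have := hf.cont_deriv
    fun_prop
  obtain ⟨g, hg, hgf⟩ : ∃ g : ℝ → ℝ, Continuous g ∧ ∀ s ∈ Icc L R, g s = gfun f f' s :=
    ⟨IccExtend hLR.le ((Icc L R).domRestrict (gfun f f')),
      (continuousOn_iff_continuous_domRestrict.1 hgc).Icc_extend',
      fun s hs => by rw [IccExtend_of_mem _ _ hs]; rfl⟩
  have hU1 := Ubar_one f f' L R hL hLR hR hf (n - 1)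
  have hcont : ∀ W, InUstar f (n - 1) W → ContinuousOn W (Icc L R) := by
    intro W hW
    have : LipschitzOnWith 2 W (Icc 0 1) :=
      LipschitzOnWith.of_dist_le_mul (fun s hs t ht => ustar_lip f (n - 1) hU1 W hW s hs t ht)
    exact this.continuousOn.mono (Icc_subset_Icc hL hR)
  have hgW : ∀ W : ℝ → ℝ, ∫ s in L..R, gfun f f' s * W s = ∫ s in L..R, g s * W s := by
    intro W
    apply intervalIntegral.integral_congr
    intro s hs
    rw [uIcc_of_le hLR.le] at hs
    simp only
    rw [hgf s hs]
  have hDc : ContinuousOn (fun s => g s * (V s - U s)) (Icc L R) :=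
    hg.continuousOn.mul ((hcont V hV).sub (hcont U hU))
  have hii : ∀ W, InUstar f (n - 1) W → IntervalIntegrable (fun s => g s * W s) volume L R := by
    intro W hW
    apply ContinuousOn.intervalIntegrable
    rw [uIcc_of_le hLR.le]
    exact hg.continuousOn.mul (hcont W hW)
  have hlow : ∀ j, j ≤ m → L ≤ p j := by
    intro j
    induction j with
    | zero => intro _; exact hp0.ge
    | succ j ih => intro h; exact (ih (by omega)).trans (hmono j (by omega))
  have hup : ∀ d, d ≤ m → p (m - d) ≤ R := by
    intro d
    induction d with
    | zero => intro _; exact hpm.le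
    | succ d ih =>
      intro h
      have h1 := hmono (m - (d + 1)) (by omega)
      have e : m - (d + 1) + 1 = m - d := by omega
      rw [e] at h1
      exact h1.trans (ih (by omega))
  have hup' : ∀ j, j ≤ m → p j ≤ R := by
    intro j hj
    have := hup (m - j) (by omega)
    rwa [Nat.sub_sub_self hj] at this
  have main : ∀ j, j ≤ m → (∫ s in L..(p j), g s * (V s - U s))
      + (if L < p j then -(2 * L * (1 - L) * f L) * (V L - U L) else 0)
      + (if p j = R then 2 * R * (1 - R) * f R * (V R - U R) else 0) ≤ 0 := by
    intro j
    induction j with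
    | zero =>
      intro _
      rw [hp0]
      simp [hLR.ne]
    | succ j ih =>
      intro hj
      have ih := ih (by omega)
      rcases (hmono j (by omega)).eq_or_lt with h | h
      · rw [← h]; exact ih
      · have h1 := hlow j (by omega)
        have h2 := hup' (j + 1) hj
        have hp := piece n L R hL hLR hR f f' hf g hg hgf U V hU hV (p j) (p (j + 1)) h h1 h2
          (haffine j (by omega)) (hcases j (by omega))
        have i1 : IntervalIntegrable (fun s => g s * (V s - U s)) volume L (p j) := by
          apply ContinuousOn.intervalIntegrable
          rw [uIcc_of_le h1]
          exact hDc.mono (Icc_subset_Icc le_rfl (h.le.trans h2))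
        have i2 : IntervalIntegrable (fun s => g s * (V s - U s)) volume (p j) (p (j + 1)) := by
          apply ContinuousOn.intervalIntegrable
          rw [uIcc_of_le h.le]
          exact hDc.mono (Icc_subset_Icc h1 h2)
        rw [← intervalIntegral.integral_add_adjacent_intervals i1 i2]
        have n1 : p j ≠ R := (h.trans_le h2).ne
        have n2 : L < p (j + 1) := h1.trans_lt h
        rw [if_neg n1] at ih
        rw [if_pos n2]
        have hb : (if p (j + 1) = R then 2 * R * (1 - R) * f R else 0) * (V (p (j + 1)) - U (p (j + 1)))
            = (if p (j + 1) = R then 2 * R * (1 - R) * f R * (V R - U R) else 0) := by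
          split_ifs with h
          · rw [h]
          · simp
        rw [hb] at hp
        rcases h1.eq_or_lt with h3 | h3
        · rw [if_pos h3.symm] at hp
          rw [if_neg (by rw [← h3]; exact lt_irrefl _)] at ih
          rw [← h3] at hp ih ⊢
          linarith
        · rw [if_neg h3.ne'] at hp
          rw [if_pos h3] at ih
          linarith
  have hfin := main m le_rfl
  rw [hpm, if_pos hLR, if_pos rfl] at hfin
  have hsplit : ∫ s in L..R, g s * (V s - U s)
      = (∫ s in L..R, g s * V s) - ∫ s in L..R, g s * U s := by
    rw [← intervalIntegral.integral_sub (hii V hV) (hii U hU)]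
    congr 1; funext s; ring
  rw [hsplit] at hfin
  unfold Jfun
  rw [hgW, hgW]
  linarith
end
end

section
/- Suppose L ≤ smin ≤ smax ≤ R satisfy: g(s) ≤ 0 for all s ∈ [L, smin]; g(s) ≥ 0 for all s ∈ [smax, R]; (Sign) ∫_{smin}^{smax} g(t) dt − 1{smin = L}·2·L·(1−L)·f(L) + 1{smax = R}·2·R·(1−R)·f(R) ≥ 0; and (Dominance) for all s ∈ [smin, smax], ∫_{smin}^{s} (s − t)·g(t) dt − 1{smin = L}·2·(s − L)·L·(1−L)·f(L) ≤ 0, with equality at s = smax. If U ∈ 𝒰* satisfies U(s) = 0 for all s ∈ [L, smin], U is affine on [smin, smax], and U(s) = Ubar(s) for all s ∈ [smax, R], then ∫_{[L,R]} U dμ_f ≥ ∫_{[L,R]} V dμ_f for every V ∈ 𝒰*. -/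
open MeasureTheory Set Filter
open scoped Classical

noncomputable section

lemma aux_step (g V : ℝ → ℝ) (p q a M : ℝ) (hpq : p ≤ q)
    (hg : ContinuousOn g (Icc p q)) (hM : ∀ t ∈ Icc p q, |g t| ≤ M)
    (hV : MonotoneOn V (Icc p q)) (x y m : ℝ) (hx : p ≤ x) (hxy : x ≤ y) (hy : y ≤ q)
    (hm : V y = V x + m * (y - x)) (hm0 : 0 ≤ m) :
    (∫ t in p..y, g t * V t) - a * V p - V y * ((∫ t in p..y, g t) - a)
      + m * ((∫ t in p..y, (y - t) * g t) - a * (y - p)) ≤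
    (∫ t in p..x, g t * V t) - a * V p - V x * ((∫ t in p..x, g t) - a)
      + m * ((∫ t in p..x, (x - t) * g t) - a * (x - p)) + M * (y - x) * (V y - V x) := by
  have hgi : ∀ u v, p ≤ u → u ≤ v → v ≤ q → IntervalIntegrable g volume u v := by
    intro u v h1 h2 h3
    apply ContinuousOn.intervalIntegrable
    rw [uIcc_of_le h2]
    exact hg.mono (Icc_subset_Icc h1 h3)
  have hti : ∀ c u v, p ≤ u → u ≤ v → v ≤ q →
      IntervalIntegrable (fun t => (c - t) * g t) volume u v := by
    intro c u v h1 h2 h3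
    exact (hgi u v h1 h2 h3).continuousOn_mul (by fun_prop)
  have hVi : ∀ u v, p ≤ u → u ≤ v → v ≤ q →
      IntervalIntegrable (fun t => g t * V t) volume u v := by
    intro u v h1 h2 h3
    have hh : IntervalIntegrable V volume u v := by
      apply MonotoneOn.intervalIntegrable
      rw [uIcc_of_le h2]
      exact hV.mono (Icc_subset_Icc h1 h3)
    refine hh.continuousOn_mul ?_
    rw [uIcc_of_le h2]
    exact hg.mono (Icc_subset_Icc h1 h3)
  have e1 := intervalIntegral.integral_add_adjacent_intervals
    (hVi p x le_rfl hx (hxy.trans hy)) (hVi x y hx hxy hy)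
  have e2 := intervalIntegral.integral_add_adjacent_intervals
    (hgi p x le_rfl hx (hxy.trans hy)) (hgi x y hx hxy hy)
  have e3 := intervalIntegral.integral_add_adjacent_intervals
    (hti y p x le_rfl hx (hxy.trans hy)) (hti y x y hx hxy hy)
  have e4 : (∫ t in p..x, (y - t) * g t) =
      (∫ t in p..x, (x - t) * g t) + (y - x) * ∫ t in p..x, g t := by
    rw [← intervalIntegral.integral_const_mul, ← intervalIntegral.integral_add
      (hti x p x le_rfl hx (hxy.trans hy)) ((hgi p x le_rfl hx (hxy.trans hy)).const_mul _)]
    congr 1; ext t; ring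
  have e5 : (∫ t in x..y, g t * (V t - V y + m * (y - t))) =
      (∫ t in x..y, g t * V t) - V y * (∫ t in x..y, g t)
        + m * ∫ t in x..y, (y - t) * g t := by
    rw [← intervalIntegral.integral_const_mul, ← intervalIntegral.integral_const_mul,
      ← intervalIntegral.integral_sub (hVi x y hx hxy hy) ((hgi x y hx hxy hy).const_mul _),
      ← intervalIntegral.integral_add
      ((hVi x y hx hxy hy).sub ((hgi x y hx hxy hy).const_mul _))
      ((hti y x y hx hxy hy).const_mul _)]
    congr 1; ext t; ring
  have e6 : |∫ t in x..y, g t * (V t - V y + m * (y - t))| ≤ (M * (V y - V x)) * |y - x| := by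
    rw [← Real.norm_eq_abs]
    apply intervalIntegral.norm_integral_le_of_norm_le_const
    intro t ht
    rw [uIoc_of_le hxy] at ht
    have htm : t ∈ Icc p q := ⟨by linarith [ht.1], by linarith [ht.2]⟩
    rw [Real.norm_eq_abs, abs_mul]
    have b1 := hV ⟨hx, hxy.trans hy⟩ htm ht.1.le
    have b2 := hV htm ⟨hx.trans hxy, hy⟩ ht.2
    have b3 : 0 ≤ m * (y - t) := mul_nonneg hm0 (by linarith [ht.2])
    have b4 : 0 ≤ m * (t - x) := mul_nonneg hm0 (by linarith [ht.1])
    apply mul_le_mul (hM t htm) _ (abs_nonneg _) ((abs_nonneg _).trans (hM t htm))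
    rw [abs_le]
    constructor <;> nlinarith
  rw [abs_of_nonneg (sub_nonneg.2 hxy)] at e6
  have e7 := (le_abs_self _).trans e6
  rw [e5] at e7
  rw [← e1, ← e2, ← e3, e4]
  have hm' : V x = V y - m * (y - x) := by linarith
  rw [hm'] at e7 ⊢
  linarith

lemma aux_ind (g V : ℝ → ℝ) (p q a M : ℝ) (hpq : p < q)
    (hg : ContinuousOn g (Icc p q)) (hM : ∀ t ∈ Icc p q, |g t| ≤ M)
    (hV : MonotoneOn V (Icc p q)) (hc : ConvexOn ℝ (Icc p q) V)
    (hK : ∀ s ∈ Icc p q, (∫ t in p..s, (s - t) * g t) - a * (s - p) ≤ 0)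
    (h : ℝ) (hh : 0 < h) (k : ℕ) : p + k * h ≤ q →
    ∃ m : ℝ, 0 ≤ m ∧ (∀ z, p + k * h < z → z ≤ q →
        m * (z - (p + k * h)) ≤ V z - V (p + k * h)) ∧
      (∫ t in p..(p + k * h), g t * V t) - a * V p
        - V (p + k * h) * ((∫ t in p..(p + k * h), g t) - a)
        + m * ((∫ t in p..(p + k * h), (p + k * h - t) * g t) - a * (p + k * h - p))
      ≤ M * h * (V (p + k * h) - V p) := by
  induction k with
  | zero =>
    intro _
    refine ⟨0, le_rfl, ?_, ?_⟩
    · intro z h1 h2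
      simp only [Nat.cast_zero, zero_mul, add_zero] at h1 ⊢
      have := hV ⟨le_rfl, hpq.le⟩ ⟨h1.le, h2⟩ h1.le
      linarith
    · simp; linarith
  | succ k ih =>
    intro hk
    have hxy : p + (k : ℝ) * h ≤ p + ((k + 1 : ℕ) : ℝ) * h := by push_cast; linarith
    have hyx : p + ((k + 1 : ℕ) : ℝ) * h - (p + (k : ℝ) * h) = h := by push_cast; ring
    have hpx : p ≤ p + (k : ℝ) * h := by
      have : 0 ≤ (k : ℝ) * h := by positivity
      linarith
    obtain ⟨m0, hm0, hs, hb⟩ := ih (hxy.trans hk)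
    generalize p + (k : ℝ) * h = x at *
    generalize p + ((k + 1 : ℕ) : ℝ) * h = y at *
    have hlt : x < y := by linarith
    have hxm : x ∈ Icc p q := ⟨hpx, hxy.trans hk⟩
    have hym : y ∈ Icc p q := ⟨hpx.trans hxy, hk⟩
    have hmy : (V y - V x) / h * h = V y - V x := by field_simp
    have hmm : m0 ≤ (V y - V x) / h := by
      rw [le_div_iff₀ hh, ← hyx]; exact hs y hlt hk
    refine ⟨(V y - V x) / h, hm0.trans hmm, ?_, ?_⟩
    · intro z h1 h2
      have := hc.slope_mono_adjacent hxm ⟨hym.1.trans h1.le, h2⟩ hlt h1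
      rw [hyx, le_div_iff₀ (by linarith)] at this
      exact this
    · have st := aux_step g V p q a M hpq.le hg hM hV x y ((V y - V x) / h) hpx hxy hk
        (by rw [hyx, hmy]; ring) (hm0.trans hmm)
      rw [hyx] at st
      have := mul_le_mul_of_nonpos_right hmm (hK x hxm)
      linarith

lemma aux_main (g V : ℝ → ℝ) (p q a : ℝ) (hpq : p ≤ q)
    (hg : ContinuousOn g (Icc p q))
    (hV : MonotoneOn V (Icc p q)) (hc : ConvexOn ℝ (Icc p q) V)
    (hK : ∀ s ∈ Icc p q, (∫ t in p..s, (s - t) * g t) - a * (s - p) ≤ 0)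
    (hKq : (∫ t in p..q, (q - t) * g t) - a * (q - p) = 0) :
    (∫ t in p..q, g t * V t) - a * V p ≤ V q * ((∫ t in p..q, g t) - a) := by
  rcases hpq.eq_or_lt with rfl | hpq
  · simp; linarith
  obtain ⟨M, hM⟩ := isCompact_Icc.exists_bound_of_continuousOn hg
  have key : ∀ N : ℕ, (∫ t in p..q, g t * V t) - a * V p - V q * ((∫ t in p..q, g t) - a)
      ≤ (M * (q - p) * (V q - V p)) * (1 / ((N : ℝ) + 1)) := by
    intro N
    have hN : (0 : ℝ) < (N : ℝ) + 1 := by positivity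
    have e : p + ((N + 1 : ℕ) : ℝ) * ((q - p) / ((N : ℝ) + 1)) = q := by
      push_cast; field_simp; ring
    obtain ⟨m, -, -, hb⟩ := aux_ind g V p q a M hpq hg hM hV hc hK ((q - p) / ((N : ℝ) + 1))
      (div_pos (by linarith) hN) (N + 1) e.le
    rw [e, hKq] at hb
    rw [mul_zero, add_zero] at hb
    refine hb.trans (le_of_eq ?_)
    ring
  have lim : Tendsto (fun N : ℕ => (M * (q - p) * (V q - V p)) * (1 / ((N : ℝ) + 1))) atTop
      (nhds ((M * (q - p) * (V q - V p)) * 0)) :=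
    tendsto_one_div_add_atTop_nhds_zero_nat.const_mul _
  have := ge_of_tendsto' lim key
  linarith

theorem stmt14 (n : ℕ) (hn : 2 ≤ n) (L R : ℝ) (hL : 0 ≤ L) (hLR : L < R) (hR : R ≤ 1)
    (f f' : ℝ → ℝ) (hf : Density f f' L R)
    (smin smax : ℝ) (h1 : L ≤ smin) (h2 : smin ≤ smax) (h3 : smax ≤ R)
    (hgneg : ∀ s ∈ Set.Icc L smin, gfun f f' s ≤ 0)
    (hgpos : ∀ s ∈ Set.Icc smax R, 0 ≤ gfun f f' s)
    (hsign : 0 ≤ (∫ t in smin..smax, gfun f f' t) -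
        (if smin = L then 2 * L * (1 - L) * f L else 0) +
        (if smax = R then 2 * R * (1 - R) * f R else 0))
    (hdom : ∀ s ∈ Set.Icc smin smax,
      (∫ t in smin..s, (s - t) * gfun f f' t) -
        (if smin = L then 2 * (s - L) * L * (1 - L) * f L else 0) ≤ 0)
    (hdomeq : (∫ t in smin..smax, (smax - t) * gfun f f' t) -
        (if smin = L then 2 * (smax - L) * L * (1 - L) * f L else 0) = 0)
    (U : ℝ → ℝ) (hU : InUstar f (n - 1) U)
    (hU0 : ∀ s ∈ Set.Icc L smin, U s = 0)
    (hUaff : ∃ α β : ℝ, ∀ s ∈ Set.Icc smin smax, U s = α * s + β)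
    (hUtop : ∀ s ∈ Set.Icc smax R, U s = Ubar f (n - 1) s) :
    ∀ Vfun : ℝ → ℝ, InUstar f (n - 1) Vfun →
      Jfun f f' L R Vfun ≤ Jfun f f' L R U := by
  intro V hVu
  have hgc : ContinuousOn (gfun f f') (Icc L R) := by
    have hfc : ContinuousOn f (Icc L R) := fun s hs => (hf.hderiv s hs).continuousWithinAt
    have hfc' := hf.cont_deriv
    unfold gfun
    fun_prop
  have hsub : Icc L R ⊆ Icc (0:ℝ) 1 := Icc_subset_Icc hL hR
  unfold Jfun
  generalize gfun f f' = g at *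
  have hfL := hf.nonneg L
  have hfR := hf.nonneg R
  have ha : 0 ≤ 2 * L * (1 - L) * f L :=
    mul_nonneg (mul_nonneg (by linarith) (by linarith)) hfL
  have hb : 0 ≤ 2 * R * (1 - R) * f R :=
    mul_nonneg (mul_nonneg (by linarith) (by linarith)) hfR
  have hii : ∀ W, MonotoneOn W (Icc (0:ℝ) 1) → ∀ u v, L ≤ u → u ≤ v → v ≤ R →
      IntervalIntegrable (fun t => g t * W t) volume u v := by
    intro W hW u v k1 k2 k3
    have hh : IntervalIntegrable W volume u v := by
      apply MonotoneOn.intervalIntegrable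
      rw [uIcc_of_le k2]
      exact hW.mono ((Icc_subset_Icc k1 k3).trans hsub)
    refine hh.continuousOn_mul ?_
    rw [uIcc_of_le k2]
    exact hgc.mono (Icc_subset_Icc k1 k3)
  have hsplit : ∀ W, MonotoneOn W (Icc (0:ℝ) 1) → (∫ s in L..R, g s * W s) =
      (∫ s in L..smin, g s * W s) + (∫ s in smin..smax, g s * W s)
        + ∫ s in smax..R, g s * W s := by
    intro W hW
    rw [intervalIntegral.integral_add_adjacent_intervals
      (hii W hW L smin le_rfl h1 (h2.trans h3)) (hii W hW smin smax h1 h2 h3),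
      intervalIntegral.integral_add_adjacent_intervals
      (hii W hW L smax le_rfl (h1.trans h2) h3) (hii W hW smax R (h1.trans h2) h3 le_rfl)]
  have hV0 : ∀ s ∈ Icc L R, 0 ≤ V s := fun s hs =>
    (le_max_left _ _).trans (hVu.2.2 s (hsub hs)).1
  have hVt : ∀ s ∈ Icc smax R, V s ≤ U s := by
    intro s hs
    rw [hUtop s hs]
    exact (hVu.2.2 s (hsub ⟨(h1.trans h2).trans hs.1, hs.2⟩)).2
  have low : (∫ s in L..smin, g s * V s) ≤ ∫ s in L..smin, g s * U s := by
    apply intervalIntegral.integral_mono_on h1 (hii V hVu.1 L smin le_rfl h1 (h2.trans h3))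
      (hii U hU.1 L smin le_rfl h1 (h2.trans h3))
    intro s hs
    rw [hU0 s hs, mul_zero]
    exact mul_nonpos_of_nonpos_of_nonneg (hgneg s hs)
      (hV0 s ⟨hs.1, hs.2.trans (h2.trans h3)⟩)
  have high : (∫ s in smax..R, g s * V s) ≤ ∫ s in smax..R, g s * U s := by
    apply intervalIntegral.integral_mono_on h3 (hii V hVu.1 smax R (h1.trans h2) h3 le_rfl)
      (hii U hU.1 smax R (h1.trans h2) h3 le_rfl)
    intro s hs
    exact mul_le_mul_of_nonneg_left (hVt s hs) (hgpos s hs)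
  obtain ⟨a, hadef⟩ : ∃ a, a = if smin = L then 2 * L * (1 - L) * f L else 0 := ⟨_, rfl⟩
  obtain ⟨b, hbdef⟩ : ∃ b, b = if smax = R then 2 * R * (1 - R) * f R else 0 := ⟨_, rfl⟩
  have hconv : ∀ s, (if smin = L then 2 * (s - L) * L * (1 - L) * f L else 0)
      = a * (s - smin) := by
    intro s
    by_cases hc : smin = L
    · rw [hadef, if_pos hc, if_pos hc, hc]; ring
    · rw [hadef, if_neg hc, if_neg hc]; ring
  rw [← hadef, ← hbdef] at hsign
  simp only [hconv] at hdom hdomeq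
  have hms : Icc smin smax ⊆ Icc L R := Icc_subset_Icc h1 h3
  have mid := aux_main g V smin smax a h2 (hgc.mono hms) (hVu.1.mono (hms.trans hsub))
    (hVu.2.1.subset (hms.trans hsub) (convex_Icc _ _)) hdom hdomeq
  have midU : (∫ t in smin..smax, g t * U t) - a * U smin
      = U smax * ((∫ t in smin..smax, g t) - a) := by
    obtain ⟨α, β, hab⟩ := hUaff
    have hgi : IntervalIntegrable g volume smin smax := by
      apply ContinuousOn.intervalIntegrable
      rw [uIcc_of_le h2]
      exact hgc.mono hms
    have e : (∫ t in smin..smax, g t * U t) =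
        U smax * (∫ t in smin..smax, g t) - α * ∫ t in smin..smax, (smax - t) * g t := by
      rw [← intervalIntegral.integral_const_mul, ← intervalIntegral.integral_const_mul,
        ← intervalIntegral.integral_sub (hgi.const_mul _)
          ((hgi.continuousOn_mul (by fun_prop)).const_mul _)]
      apply intervalIntegral.integral_congr
      intro t ht
      rw [uIcc_of_le h2] at ht
      simp only
      rw [hab t ht, hab smax ⟨h2, le_rfl⟩]
      ring
    have e2 : (∫ t in smin..smax, (smax - t) * g t) = a * (smax - smin) := by linarith
    rw [e, e2, hab smax ⟨h2, le_rfl⟩, hab smin ⟨le_rfl, h2⟩]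
    ring
  have hq := mul_le_mul_of_nonneg_right (hVt smax ⟨le_rfl, h3⟩) hsign
  have atL : a * V smin - 2 * L * (1 - L) * f L * V L
      ≤ a * U smin - 2 * L * (1 - L) * f L * U L := by
    by_cases hc : smin = L
    · rw [hadef, if_pos hc, hc]; linarith
    · rw [hadef, if_neg hc, hU0 L ⟨le_rfl, h1⟩]
      have := mul_nonneg ha (hV0 L ⟨le_rfl, hLR.le⟩)
      linarith
  have atR : 2 * R * (1 - R) * f R * V R - b * V smax
      ≤ 2 * R * (1 - R) * f R * U R - b * U smax := by
    by_cases hc : smax = R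
    · rw [hbdef, if_pos hc, hc]; linarith
    · rw [hbdef, if_neg hc]
      have := mul_le_mul_of_nonneg_left (hVt R ⟨h3, le_rfl⟩) hb
      linarith
  rw [hsplit V hVu.1, hsplit U hU.1]
  linarith
end
end

section
/- The first-best utility Ubar is differentiable at every s ∈ (0,1) with derivative Ubar'(s) = 2^(n−1)·∫_{[0,1]^(n−1)} (w⁺(y) + w⁻(y))·1{s·∏_{k=1}^{n−1} y_k ≥ (1−s)·∏(1−y_k)} dy; Ubar is strictly convex on (0,1); and the right derivative of Ubar at 0 equals 0. -/
open MeasureTheory Set Filter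

noncomputable section

lemma null_aux (k : ℕ) (s : ℝ) (hs : s ≠ 1) :
    ∀ᵐ y : Fin (k+1) → ℝ, s * ∏ i, y i ≠ (1 - s) * ∏ i, (1 - y i) := by
  have h1 : ∀ᵐ p : ℝ × (Fin k → ℝ),
      s * (p.1 * ∏ i, p.2 i) ≠ (1 - s) * ((1 - p.1) * ∏ i, (1 - p.2 i)) := by
    have hm : MeasurableSet {p : ℝ × (Fin k → ℝ) |
      ¬ (s * (p.1 * ∏ i, p.2 i) ≠ (1 - s) * ((1 - p.1) * ∏ i, (1 - p.2 i)))} := by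
      simp only [ne_eq, not_not]
      apply IsClosed.measurableSet
      apply isClosed_eq <;> fun_prop
    rw [ae_iff, Measure.volume_eq_prod, Measure.prod_apply_symm hm, lintegral_eq_zero_iff']
    · have h2 : ∀ᵐ z : Fin k → ℝ, ∀ i, z i ≠ 1 := by
        rw [ae_all_iff]
        intro i
        rw [ae_iff]
        simp only [ne_eq, not_not]
        exact Measure.pi_eval_preimage_null (fun _ : Fin k => (volume : Measure ℝ)) (i := i)
          (s := {1}) (by simp)
      filter_upwards [h2] with z hz
      have hQ : (1 - s) * ∏ i, (1 - z i) ≠ 0 := by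
        apply mul_ne_zero (sub_ne_zero.2 (Ne.symm hs))
        exact Finset.prod_ne_zero_iff.2 fun i _ => sub_ne_zero.2 (Ne.symm (hz i))
      apply Set.Subsingleton.measure_zero
      intro a ha b hb
      simp only [ne_eq, not_not, mem_preimage, mem_setOf_eq] at ha hb
      generalize (∏ i, z i) = P at *
      generalize (∏ i, (1 - z i)) = Q at *
      have h3 : (a - b) * (s * P + (1 - s) * Q) = 0 := by linear_combination ha - hb
      rcases mul_eq_zero.1 h3 with h | h
      · linarith
      · exfalso; apply hQ; linear_combination -ha + a * h
    · exact (measurable_measure_prodMk_right hm).aemeasurable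
  have h4 := (volume_preserving_piFinSuccAbove (fun _ : Fin (k+1) => ℝ) 0).quasiMeasurePreserving.ae h1
  filter_upwards [h4] with y hy
  rw [Fin.prod_univ_succ, Fin.prod_univ_succ]
  exact hy

lemma cube_compact (m : ℕ) : IsCompact (cube m) := isCompact_univ_pi fun _ => isCompact_Icc

section
variable {f f' : ℝ → ℝ} {m : ℕ}

lemma dens_cont (hf : Density f f' 0 1) : ContinuousOn f (Icc 0 1) :=
  fun s hs => (hf.hderiv s hs).continuousWithinAt

lemma fk_cont (hf : Density f f' 0 1) (k : Fin m) :
    ContinuousOn (fun y : Fin m → ℝ => f (y k)) (cube m) :=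
  (dens_cont hf).comp (continuous_apply k).continuousOn (fun y hy => hy k (mem_univ k))

lemma wplus_cont (hf : Density f f' 0 1) :
    ContinuousOn (fun y : Fin m → ℝ => wplus f y) (cube m) :=
  continuousOn_finset_prod _ fun k _ => (continuous_apply k).continuousOn.mul (fk_cont hf k)

lemma wminus_cont (hf : Density f f' 0 1) :
    ContinuousOn (fun y : Fin m → ℝ => wminus f y) (cube m) :=
  continuousOn_finset_prod _ fun k _ =>
    (continuous_const.sub (continuous_apply k)).continuousOn.mul (fk_cont hf k)

lemma wplus_nonneg (hf : Density f f' 0 1) {y : Fin m → ℝ} (hy : y ∈ cube m) : 0 ≤ wplus f y :=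
  Finset.prod_nonneg fun k _ => mul_nonneg (hy k (mem_univ k)).1 (hf.nonneg _)

lemma wminus_nonneg (hf : Density f f' 0 1) {y : Fin m → ℝ} (hy : y ∈ cube m) : 0 ≤ wminus f y :=
  Finset.prod_nonneg fun k _ =>
    mul_nonneg (sub_nonneg.2 (hy k (mem_univ k)).2) (hf.nonneg _)

/-- The derivative integrand. -/
def dint (f : ℝ → ℝ) {m : ℕ} (s : ℝ) (y : Fin m → ℝ) : ℝ :=
  if (1 - s) * ∏ k, (1 - y k) ≤ s * ∏ k, y k then wplus f y + wminus f y else 0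

lemma deriv_aux (hf : Density f f' 0 1) (s : ℝ) (hs : s ≠ 1) (k : ℕ) :
    Integrable (dint f s) (volume.restrict (cube (k+1))) ∧
    HasDerivAt (Ubar f (k+1)) ((2:ℝ) ^ (k+1) * ∫ y in cube (k+1), dint f s y) s := by
  have hcm : MeasurableSet (cube (k+1)) := (cube_compact _).isClosed.measurableSet
  have hFc : ∀ x : ℝ, ContinuousOn (fun y : Fin (k+1) → ℝ =>
      max (x * wplus f y - (1 - x) * wminus f y) 0) (cube (k+1)) := fun x =>
    ((continuousOn_const.mul (wplus_cont hf)).sub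
      (continuousOn_const.mul (wminus_cont hf))).sup continuousOn_const
  have hsum : ContinuousOn (fun y : Fin (k+1) → ℝ => wplus f y + wminus f y) (cube (k+1)) :=
    (wplus_cont hf).add (wminus_cont hf)
  have key := hasDerivAt_integral_of_dominated_loc_of_lip (μ := volume.restrict (cube (k+1)))
    (F := fun (x : ℝ) (y : Fin (k+1) → ℝ) => max (x * wplus f y - (1 - x) * wminus f y) 0)
    (F' := dint f s) (x₀ := s) (s := univ) (bound := fun y => wplus f y + wminus f y)
    univ_mem (Eventually.of_forall fun x => (hFc x).aestronglyMeasurable hcm)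
    ((hFc s).integrableOn_compact (cube_compact _)) ?_ ?_
    (hsum.integrableOn_compact (cube_compact _)) ?_
  · exact ⟨key.1, key.2.const_mul _⟩
  · have : dint f s = indicator {y : Fin (k+1) → ℝ | (1 - s) * ∏ k, (1 - y k) ≤ s * ∏ k, y k}
        (fun y => wplus f y + wminus f y) := by
      ext y; simp [dint, indicator]
    rw [this]
    refine (hsum.aestronglyMeasurable hcm).indicator (IsClosed.measurableSet ?_)
    apply isClosed_le <;> fun_prop
  · refine Eventually.of_forall fun y => LipschitzOnWith.of_dist_le_mul fun a _ b _ => ?_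
    rw [Real.dist_eq, Real.dist_eq]
    refine (abs_max_sub_max_le_abs _ _ _).trans ?_
    rw [Real.coe_nnabs, ← abs_mul]
    apply le_of_eq; congr 1; ring
  · filter_upwards [ae_restrict_of_ae (null_aux k s hs), ae_restrict_mem hcm] with y hy hyc
    have hPhi : 0 < ∏ i, f (y i) := Finset.prod_pos fun i _ => hf.pos _ (hyc i (mem_univ i))
    have hwp : wplus f y = (∏ i, y i) * ∏ i, f (y i) := Finset.prod_mul_distrib
    have hwm : wminus f y = (∏ i, (1 - y i)) * ∏ i, f (y i) := Finset.prod_mul_distrib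
    have hg : HasDerivAt (fun x : ℝ => x * wplus f y - (1 - x) * wminus f y)
        (wplus f y + wminus f y) s := by
      have := ((hasDerivAt_id s).mul_const (wplus f y)).sub
        (((hasDerivAt_id s).const_sub 1).mul_const (wminus f y))
      exact this.congr_deriv (by ring)
    have hval : s * wplus f y - (1 - s) * wminus f y
        = (s * ∏ i, y i - (1 - s) * ∏ i, (1 - y i)) * ∏ i, f (y i) := by
      rw [hwp, hwm]; ring
    rcases lt_or_gt_of_ne hy with h | h
    · have h1 : dint f s y = 0 := by simp [dint, h]
      rw [h1]
      have h2 : s * wplus f y - (1 - s) * wminus f y < 0 := by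
        rw [hval]; exact mul_neg_of_neg_of_pos (by linarith) hPhi
      refine (hasDerivAt_const s (0:ℝ)).congr_of_eventuallyEq ?_
      filter_upwards [hg.continuousAt.eventually_lt_const h2] with x hx
      exact max_eq_right hx.le
    · have h1 : dint f s y = wplus f y + wminus f y := by simp [dint, h.le]
      rw [h1]
      have h2 : 0 < s * wplus f y - (1 - s) * wminus f y := by
        rw [hval]; exact mul_pos (by linarith) hPhi
      refine hg.congr_of_eventuallyEq ?_
      filter_upwards [hg.continuousAt.eventually_const_lt h2] with x hx
      exact max_eq_left hx.le

lemma mono_aux (hf : Density f f' 0 1) (k : ℕ) {s t : ℝ} (hs : 0 < s) (hst : s < t) (ht : t < 1) :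
    ∫ y in cube (k+1), dint f s y < ∫ y in cube (k+1), dint f t y := by
  have is := (deriv_aux hf s (by linarith : s < 1).ne k).1
  have it := (deriv_aux hf t ht.ne k).1
  have hcm : MeasurableSet (cube (k+1)) := (cube_compact _).isClosed.measurableSet
  rw [← sub_pos, ← integral_sub it is, integral_pos_iff_support_of_nonneg_ae]
  rotate_left
  · filter_upwards [ae_restrict_mem hcm] with y hy
    have h1 := wplus_nonneg hf hy
    have h2 := wminus_nonneg hf hy
    have hP : 0 ≤ ∏ i, y i := Finset.prod_nonneg fun i _ => (hy i (mem_univ i)).1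
    have hQ : 0 ≤ ∏ i, (1 - y i) :=
      Finset.prod_nonneg fun i _ => sub_nonneg.2 (hy i (mem_univ i)).2
    simp only [dint, Pi.zero_apply]
    split_ifs with a b b
    · simp
    · linarith
    · exfalso; apply a; nlinarith
    · simp
  · exact it.sub is
  set V : Set (Fin (k+1) → ℝ) := {y | (∀ i, 0 < y i ∧ y i < 1) ∧
    (1 - t) * ∏ k, (1 - y k) < t * ∏ k, y k ∧ s * ∏ k, y k < (1 - s) * ∏ k, (1 - y k)} with hV
  have hVo : IsOpen V := by
    have e : V = (⋂ i, {y | 0 < y i} ∩ {y | y i < 1}) ∩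
      ({y | (1 - t) * ∏ k, (1 - y k) < t * ∏ k, y k} ∩
       {y | s * ∏ k, y k < (1 - s) * ∏ k, (1 - y k)}) := by
      ext y; simp [hV]
    rw [e]
    refine (isOpen_iInter_of_finite fun i => (isOpen_lt (by fun_prop) (by fun_prop)).inter
      (isOpen_lt (by fun_prop) (by fun_prop))).inter
      ((isOpen_lt (by fun_prop) (by fun_prop)).inter (isOpen_lt (by fun_prop) (by fun_prop)))
  have hVn : V.Nonempty := by
    obtain ⟨u, hsu, hut⟩ := exists_between hst
    have hc : ContinuousOn (fun c : ℝ => u * c ^ (k+1) - (1 - u) * (1 - c) ^ (k+1)) (Icc 0 1) := by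
      fun_prop
    obtain ⟨c, hc, hc0⟩ := intermediate_value_Ioo zero_le_one hc
      (show (0:ℝ) ∈ Ioo _ _ by constructor <;> simp <;> linarith)
    have hp : 0 < c ^ (k+1) := pow_pos hc.1 _
    have hq : 0 < (1 - c) ^ (k+1) := pow_pos (by linarith [hc.2]) _
    refine ⟨fun _ => c, fun _ => hc, ?_, ?_⟩ <;>
      simp only [Finset.prod_const, Finset.card_univ, Fintype.card_fin] <;> nlinarith
  have hVs : V ⊆ Function.support (fun y => dint f t y - dint f s y) ∩ cube (k+1) := by
    rintro y ⟨h1, h2, h3⟩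
    have hyc : y ∈ cube (k+1) := fun i _ => ⟨(h1 i).1.le, (h1 i).2.le⟩
    refine ⟨?_, hyc⟩
    have hp : 0 < wplus f y :=
      Finset.prod_pos fun i _ => mul_pos (h1 i).1 (hf.pos _ (hyc i (mem_univ i)))
    have hm := wminus_nonneg hf hyc
    simp only [Function.mem_support, dint, if_pos h2.le, if_neg (not_le.2 h3)]
    intro h; linarith
  rw [Measure.restrict_apply' hcm]
  exact (hVo.measure_pos volume hVn).trans_le (measure_mono hVs)

end

theorem stmt17 (n : ℕ) (hn : 2 ≤ n) (f f' : ℝ → ℝ) (hf : Density f f' 0 1) :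
    (∀ s ∈ Set.Ioo (0:ℝ) 1,
      HasDerivAt (Ubar f (n - 1))
        ((2:ℝ) ^ (n - 1) * ∫ y in cube (n - 1),
          (if (1 - s) * ∏ k, (1 - y k) ≤ s * ∏ k, y k then wplus f y + wminus f y else 0))
        s) ∧
    StrictConvexOn ℝ (Set.Ioo (0:ℝ) 1) (Ubar f (n - 1)) ∧
    HasDerivWithinAt (Ubar f (n - 1)) 0 (Set.Ici (0:ℝ)) 0 := by
  obtain ⟨k, rfl⟩ : ∃ k, n = k + 2 := ⟨n - 2, by omega⟩
  have hD : ∀ s : ℝ, s ≠ 1 → HasDerivAt (Ubar f (k+1))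
      ((2:ℝ) ^ (k+1) * ∫ y in cube (k+1), dint f s y) s := fun s hs => (deriv_aux hf s hs k).2
  refine ⟨fun s hs => hD s hs.2.ne, ?_, ?_⟩
  · refine StrictMonoOn.strictConvexOn_of_deriv (convex_Ioo 0 1)
      (fun s hs => (hD s hs.2.ne).continuousAt.continuousWithinAt) ?_
    rw [interior_Ioo]
    intro s hs t ht hst
    rw [show k + 2 - 1 = k + 1 from rfl, (hD s hs.2.ne).deriv, (hD t ht.2.ne).deriv]
    exact mul_lt_mul_of_pos_left (mono_aux hf k hs.1 hst ht.2) (by positivity)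
  · have h0 := hD 0 zero_ne_one
    have hcm : MeasurableSet (cube (k+1)) := (cube_compact _).isClosed.measurableSet
    have : ∫ y in cube (k+1), dint f 0 y = 0 := by
      apply integral_eq_zero_of_ae
      filter_upwards [ae_restrict_of_ae (null_aux k 0 zero_ne_one), ae_restrict_mem hcm] with y hy hyc
      have hQ : 0 ≤ ∏ i, (1 - y i) :=
        Finset.prod_nonneg fun i _ => sub_nonneg.2 (hyc i (mem_univ i)).2
      have hne : ¬ ((1 - 0 : ℝ) * ∏ i, (1 - y i) ≤ 0 * ∏ i, y i) := by
        intro h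
        apply hy
        linarith
      simp only [dint, if_neg hne, Pi.zero_apply]
    rw [this, mul_zero] at h0
    exact h0.hasDerivWithinAt
end
end

section
/- For every m ≥ 1 and every s ∈ [0,1], Φ_m(s) ≤ Φ_{m+1}(s), and Φ_m converges uniformly on [0,1] to the identity: sup_{s ∈ [0,1]} |Φ_m(s) − s| → 0 as m → ∞. -/
open MeasureTheory Set Filter

noncomputable section

/-- First-best interim utility of an agent with posterior `s` observing `m`
additional conditionally independent signals. -/
def Phi (f : ℝ → ℝ) (m : ℕ) (s : ℝ) : ℝ :=
  2 ^ m * ∫ y in cube m,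
    max (s * ∏ k, y k * f (y k) - (1 - s) * ∏ k, (1 - y k) * f (y k)) 0

theorem aux_max {α : Type*} [MeasurableSpace α] (μ : Measure α) (F : α → ℝ) (hF : Integrable F μ) :
    max (∫ x, F x ∂μ) 0 ≤ ∫ x, max (F x) 0 ∂μ := by
  apply max_le
  · exact integral_mono hF hF.pos_part (fun x => le_max_left _ _)
  · exact integral_nonneg (fun x => le_max_right _ _)

theorem aux_int (μ : Measure ℝ) [SigmaFinite μ] (g h : ℝ → ℝ)
    (hg : Integrable g μ) (hh : Integrable h μ) (s : ℝ) (m : ℕ) :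
    Integrable (fun y : Fin m → ℝ => s * ∏ k, g (y k) - (1 - s) * ∏ k, h (y k))
      (Measure.pi fun _ => μ) :=
  ((Integrable.fintype_prod (f := fun _ : Fin m => g) (fun _ => hg)).const_mul s).sub
    ((Integrable.fintype_prod (f := fun _ : Fin m => h) (fun _ => hh)).const_mul (1 - s))

theorem aux_mono (μ : Measure ℝ) [SigmaFinite μ] (g h : ℝ → ℝ)
    (hg : Integrable g μ) (hh : Integrable h μ) (ig : ∫ x, g x ∂μ = 1) (ih : ∫ x, h x ∂μ = 1)
    (s : ℝ) (m : ℕ) :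
    ∫ y : Fin m → ℝ, max (s * ∏ k, g (y k) - (1 - s) * ∏ k, h (y k)) 0 ∂(Measure.pi fun _ => μ) ≤
    ∫ y : Fin (m+1) → ℝ, max (s * ∏ k, g (y k) - (1 - s) * ∏ k, h (y k)) 0
      ∂(Measure.pi fun _ => μ) := by
  have mp := (measurePreserving_piFinSuccAbove (fun _ : Fin (m+1) => μ) 0).symm
  have hint := (aux_int μ g h hg hh s (m+1))
  have hint2 := mp.integrable_comp_of_integrable hint
  have hint3 := mp.integrable_comp_of_integrable hint.pos_part
  rw [← mp.integral_comp' ]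
  have e : ∀ z : ℝ × (Fin m → ℝ), ∀ u : ℝ → ℝ,
     ∏ k, u ((MeasurableEquiv.piFinSuccAbove (fun _ : Fin (m+1) => ℝ) 0).symm z k)
      = u z.1 * ∏ k, u (z.2 k) := by
    intro z u
    rw [Fin.prod_univ_succ]
    simp [MeasurableEquiv.piFinSuccAbove]
  simp only [Function.comp_def, e] at hint2 hint3 ⊢
  rw [integral_prod_symm _ hint3]
  refine integral_mono_ae (aux_int μ g h hg hh s m).pos_part hint3.integral_prod_right ?_
  filter_upwards with y
  have hI : Integrable (fun x => s * (g x * ∏ k, g (y k)) - (1 - s) * (h x * ∏ k, h (y k))) μ :=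
    ((hg.mul_const _).const_mul s).sub ((hh.mul_const _).const_mul _)
  have := aux_max μ _ hI
  rw [integral_sub ((hg.mul_const _).const_mul s) ((hh.mul_const _).const_mul _),
    integral_const_mul, integral_const_mul, integral_mul_const, integral_mul_const, ig, ih,
    one_mul, one_mul] at this
  exact this

theorem aux_bd (p q : ℝ) (hp : 0 ≤ p) (hq : 0 ≤ q) : p - √(p * q) ≤ max (p - q) 0 := by
  rcases le_total p q with h | h
  · have : p ≤ √(p*q) := Real.le_sqrt_of_sq_le (by nlinarith)
    exact le_max_of_le_right (by linarith)
  · have : q ≤ √(p*q) := Real.le_sqrt_of_sq_le (by nlinarith)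
    exact le_max_of_le_left (by linarith)

theorem aux_lim (μ : Measure ℝ) [SigmaFinite μ] (g h r : ℝ → ℝ)
    (hg : Integrable g μ) (hh : Integrable h μ) (hr : Integrable r μ) (ig : ∫ x, g x ∂μ = 1)
    (g0 : ∀ᵐ x ∂μ, 0 ≤ g x ∧ 0 ≤ h x ∧ 0 ≤ r x ∧ g x * h x = r x ^ 2)
    (s : ℝ) (hs : s ∈ Set.Icc (0:ℝ) 1) (m : ℕ) :
    |s - ∫ y : Fin m → ℝ, max (s * ∏ k, g (y k) - (1 - s) * ∏ k, h (y k)) 0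
      ∂(Measure.pi fun _ => μ)| ≤ (∫ x, r x ∂μ) ^ m := by
  have G0 : ∀ᵐ y : Fin m → ℝ ∂(Measure.pi fun _ => μ), ∀ k,
      0 ≤ g (y k) ∧ 0 ≤ h (y k) ∧ 0 ≤ r (y k) ∧ g (y k) * h (y k) = r (y k) ^ 2 := by
    rw [ae_all_iff]
    intro k
    exact (Measure.quasiMeasurePreserving_eval (fun _ : Fin m => μ) k).ae g0
  have Ig := (Integrable.fintype_prod (f := fun _ : Fin m => g) (μ := fun _ => μ) (fun _ => hg))
  have Ir := (Integrable.fintype_prod (f := fun _ : Fin m => r) (μ := fun _ => μ) (fun _ => hr))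
  have Eg : ∫ y : Fin m → ℝ, ∏ k, g (y k) ∂(Measure.pi fun _ => μ) = 1 := by
    rw [integral_fintype_prod_eq_prod (fun _ : Fin m => g)]; simp [ig]
  have Er : ∫ y : Fin m → ℝ, ∏ k, r (y k) ∂(Measure.pi fun _ => μ) = (∫ x, r x ∂μ) ^ m := by
    rw [integral_fintype_prod_eq_prod (fun _ : Fin m => r)]; simp
  have I := (aux_int μ g h hg hh s m).pos_part
  have up : ∫ y : Fin m → ℝ, max (s * ∏ k, g (y k) - (1 - s) * ∏ k, h (y k)) 0
      ∂(Measure.pi fun _ => μ) ≤ s := by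
    calc _ ≤ ∫ y : Fin m → ℝ, s * ∏ k, g (y k) ∂(Measure.pi fun _ => μ) := by
          refine integral_mono_ae I (Ig.const_mul s) ?_
          filter_upwards [G0] with y hy
          have h1 := Finset.prod_nonneg (fun k (_ : k ∈ Finset.univ) => (hy k).1)
          have h2 := Finset.prod_nonneg (fun k (_ : k ∈ Finset.univ) => (hy k).2.1)
          have h3 := mul_nonneg hs.1 h1
          have h4 := mul_nonneg (sub_nonneg.2 hs.2) h2
          exact max_le (by linarith) h3
      _ = s := by rw [integral_const_mul, Eg, mul_one]
  have lo : s - (∫ x, r x ∂μ) ^ m ≤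
      ∫ y : Fin m → ℝ, max (s * ∏ k, g (y k) - (1 - s) * ∏ k, h (y k)) 0
      ∂(Measure.pi fun _ => μ) := by
    calc _ = ∫ y : Fin m → ℝ, (s * ∏ k, g (y k) - ∏ k, r (y k)) ∂(Measure.pi fun _ => μ) := by
            rw [integral_sub (Ig.const_mul s) Ir, integral_const_mul, Eg, Er, mul_one]
      _ ≤ _ := by
          refine integral_mono_ae ((Ig.const_mul s).sub Ir) I ?_
          filter_upwards [G0] with y hy
          have h1 := Finset.prod_nonneg (fun k (_ : k ∈ Finset.univ) => (hy k).1)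
          have h2 := Finset.prod_nonneg (fun k (_ : k ∈ Finset.univ) => (hy k).2.1)
          have h5 := Finset.prod_nonneg (fun k (_ : k ∈ Finset.univ) => (hy k).2.2.1)
          have h3 := mul_nonneg hs.1 h1
          have h4 := mul_nonneg (sub_nonneg.2 hs.2) h2
          have h6 := aux_bd _ _ h3 h4
          have h7 : (∏ k, g (y k)) * ∏ k, h (y k) = (∏ k, r (y k)) ^ 2 := by
            rw [← Finset.prod_mul_distrib, ← Finset.prod_pow]
            exact Finset.prod_congr rfl (fun k _ => (hy k).2.2.2)
          have h9 : √((s * ∏ k, g (y k)) * ((1 - s) * ∏ k, h (y k))) ≤ ∏ k, r (y k) := by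
            apply Real.sqrt_le_iff.2 ⟨h5, ?_⟩
            have : (s * ∏ k, g (y k)) * ((1 - s) * ∏ k, h (y k))
              = (s * (1 - s)) * (∏ k, r (y k)) ^ 2 := by rw [← h7]; ring
            rw [this]
            have h10 : s * (1 - s) ≤ 1 := by nlinarith [hs.1, hs.2]
            nlinarith [sq_nonneg (∏ k, r (y k))]
          exact le_trans (by linarith) h6
  rw [abs_of_nonneg (by linarith)]
  linarith

theorem aux_phi (f : ℝ → ℝ) (m : ℕ) (s : ℝ) : Phi f m s =
    ∫ y : Fin m → ℝ, max (s * ∏ k, (2 * (y k * f (y k)))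
      - (1 - s) * ∏ k, (2 * ((1 - y k) * f (y k)))) 0
      ∂(Measure.pi fun _ => (volume : Measure ℝ).restrict (Icc 0 1)) := by
  unfold Phi cube
  rw [← Measure.restrict_pi_pi, ← integral_const_mul, volume_pi]
  congr 1
  ext y
  have e : ∀ u : Fin m → ℝ, ∏ k, (2 * u k) = 2 ^ m * ∏ k, u k := fun u => by
    rw [Finset.prod_mul_distrib, Finset.prod_const, Finset.card_univ, Fintype.card_fin]
  rw [e (fun k => y k * f (y k)), e (fun k => (1 - y k) * f (y k)),
    mul_max_of_nonneg _ _ (by positivity), mul_zero]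
  congr 1
  rw [mul_sub, mul_left_comm, mul_left_comm _ (1 - s)]

theorem stmt18 (L R : ℝ) (hL : 0 ≤ L) (hLR : L < R) (hR : R ≤ 1)
    (f : ℝ → ℝ) (hnn : ∀ s, 0 ≤ f s) (hzero : ∀ s ∉ Set.Icc L R, f s = 0)
    (hpos : ∀ s ∈ Set.Icc L R, 0 < f s) (hcont : ContinuousOn f (Set.Icc L R))
    (htotal : (∫ s in L..R, f s) = 1) (hmean : (∫ s in L..R, s * f s) = 1 / 2) :
    (∀ m : ℕ, 1 ≤ m → ∀ s ∈ Set.Icc (0:ℝ) 1, Phi f m s ≤ Phi f (m + 1) s) ∧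
    TendstoUniformlyOn (fun m s => Phi f m s) id Filter.atTop (Set.Icc (0:ℝ) 1) := by
  have sub : Icc L R ⊆ Icc (0:ℝ) 1 := Icc_subset_Icc hL hR
  have key : ∀ u : ℝ → ℝ, Continuous u →
      Integrable (fun x => 2 * (u x * f x)) ((volume : Measure ℝ).restrict (Icc 0 1)) ∧
      ∫ x in Icc (0:ℝ) 1, 2 * (u x * f x) = ∫ x in L..R, 2 * (u x * f x) := by
    intro u hu
    have hz : ∀ x ∈ Icc (0:ℝ) 1 \ Icc L R, 2 * (u x * f x) = 0 := fun x hx => by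
      rw [hzero x hx.2]; simp
    have hc : ContinuousOn (fun x => 2 * (u x * f x)) (Icc L R) :=
      continuousOn_const.mul (hu.continuousOn.mul hcont)
    constructor
    · exact IntegrableOn.of_forall_sdiff_eq_zero hc.integrableOn_Icc measurableSet_Icc hz
    · rw [setIntegral_eq_of_subset_of_forall_sdiff_eq_zero measurableSet_Icc sub hz,
        integral_Icc_eq_integral_Ioc, intervalIntegral.integral_of_le hLR.le]
  obtain ⟨Ig, Eg⟩ := key (fun x => x) continuous_id
  obtain ⟨Ih, Eh⟩ := key (fun x => 1 - x) (by fun_prop)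
  obtain ⟨Ir, Er⟩ := key (fun x => √(x * (1 - x))) (by fun_prop)
  have ivf : IntervalIntegrable f volume L R := by
    apply ContinuousOn.intervalIntegrable; rwa [uIcc_of_le hLR.le]
  have ivxf : IntervalIntegrable (fun x => x * f x) volume L R := by
    apply ContinuousOn.intervalIntegrable; rw [uIcc_of_le hLR.le]
    exact continuousOn_id.mul hcont
  rw [intervalIntegral.integral_const_mul, hmean] at Eg
  have Eg1 : ∫ x in Icc (0:ℝ) 1, 2 * (x * f x) = 1 := by rw [Eg]; norm_num
  have Eh1 : ∫ x in Icc (0:ℝ) 1, 2 * ((1 - x) * f x) = 1 := by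
    rw [Eh, intervalIntegral.integral_const_mul]
    simp only [sub_mul, one_mul]
    rw [intervalIntegral.integral_sub ivf ivxf, htotal, hmean]; norm_num
  have sq : ∀ x : ℝ, 2 * √(x * (1 - x)) ≤ 1 := fun x => by
    have : √(x * (1 - x)) ≤ 1 / 2 := Real.sqrt_le_iff.2 ⟨by norm_num, by nlinarith [sq_nonneg (2 * x - 1)]⟩
    linarith
  have sqlt : ∀ x : ℝ, x ≠ 1 / 2 → 2 * √(x * (1 - x)) < 1 := fun x hx => by
    have : √(x * (1 - x)) < 1 / 2 := by
      rw [Real.sqrt_lt' (by norm_num)]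
      have : 0 < (x - 1/2) ^ 2 := by have := sub_ne_zero.2 hx; positivity
      nlinarith
    linarith
  have hr1 : ∫ x in Icc (0:ℝ) 1, 2 * (√(x * (1 - x)) * f x) < 1 := by
    rw [Er]
    refine lt_of_lt_of_eq ?_ htotal
    apply intervalIntegral.integral_lt_integral_of_continuousOn_of_le_of_exists_lt hLR
    · exact continuousOn_const.mul (ContinuousOn.mul (by fun_prop) hcont)
    · exact hcont
    · intro x _
      nlinarith [sq x, hnn x]
    · have : ∃ c ∈ Icc L R, c ≠ 1 / 2 := by
        by_cases h : L = 1 / 2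
        · exact ⟨R, ⟨hLR.le, le_rfl⟩, by linarith [h] |> fun (_ : L < R) => by rw [← h]; exact hLR.ne'⟩
        · exact ⟨L, ⟨le_rfl, hLR.le⟩, h⟩
      obtain ⟨c, hc, hne⟩ := this
      exact ⟨c, hc, by nlinarith [sqlt c hne, hpos c hc]⟩
  have hr0 : 0 ≤ ∫ x in Icc (0:ℝ) 1, 2 * (√(x * (1 - x)) * f x) :=
    integral_nonneg fun x => mul_nonneg (by norm_num) (mul_nonneg (Real.sqrt_nonneg _) (hnn x))
  refine ⟨fun m _ s _ => ?_, ?_⟩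
  · rw [aux_phi, aux_phi]
    exact aux_mono _ (fun x => 2 * (x * f x)) (fun x => 2 * ((1 - x) * f x)) Ig Ih Eg1 Eh1 s m
  · rw [Metric.tendstoUniformlyOn_iff]
    intro ε hε
    have ht := tendsto_pow_atTop_nhds_zero_of_lt_one hr0 hr1
    filter_upwards [ht.eventually (gt_mem_nhds hε)] with m hm s hs
    rw [aux_phi, Real.dist_eq]
    refine lt_of_le_of_lt ?_ hm
    refine aux_lim _ (fun x => 2 * (x * f x)) (fun x => 2 * ((1 - x) * f x))
      (fun x => 2 * (√(x * (1 - x)) * f x)) Ig Ih Ir Eg1 ?_ s hs m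
    filter_upwards [ae_restrict_mem measurableSet_Icc] with x hx
    have a := hnn x
    have b := sub_nonneg.2 hx.2
    have c := hx.1
    refine ⟨by positivity, by positivity, by positivity, ?_⟩
    have := Real.sq_sqrt (mul_nonneg c b)
    rw [mul_pow, mul_pow, this]; ring
end
end

section
/- If U is an extreme point of K, then there exist 0 ≤ smin ≤ smax ≤ 1 such that U is affine on [smin, smax] and U(s) = max(0, 2s−1) for every s ∈ [0,1] outside the open interval (smin, smax). -/
open Set

/-- the set of admissible functions -/
def KK19 : Set (ℝ → ℝ) := {W : ℝ → ℝ | MonotoneOn W (Set.Icc (0:ℝ) 1) ∧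
        ConvexOn ℝ (Set.Icc (0:ℝ) 1) W ∧
        (∀ s ∈ Set.Icc (0:ℝ) 1, max 0 (2 * s - 1) ≤ W s ∧ W s ≤ s) ∧
        (∀ s ∉ Set.Icc (0:ℝ) 1, W s = 0)}

lemma subgrad19 {U : ℝ → ℝ} (hc : ConvexOn ℝ (Icc (0:ℝ) 1) U) {x : ℝ} (h0 : 0 < x) (h1 : x < 1) :
    ∃ p : ℝ, ∀ s ∈ Icc (0:ℝ) 1, U x + p * (s - x) ≤ U s := by
  have hx : x ∈ Icc (0:ℝ) 1 := ⟨h0.le, h1.le⟩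
  obtain ⟨p, hp1, hp2⟩ := exists_between_of_forall_le
    (s := (fun z => (U x - U z) / (x - z)) '' Ico 0 x)
    (t := (fun z => (U z - U x) / (z - x)) '' Ioc x 1)
    ⟨_, mem_image_of_mem _ (left_mem_Ico.2 h0)⟩ ⟨_, mem_image_of_mem _ (right_mem_Ioc.2 h1)⟩ (by
      rintro _ ⟨a, ha, rfl⟩ _ ⟨b, hb, rfl⟩
      exact hc.slope_mono_adjacent ⟨ha.1, by linarith [ha.2]⟩ ⟨by linarith [hb.1], hb.2⟩ ha.2 hb.1)
  refine ⟨p, fun s hs => ?_⟩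
  rcases lt_trichotomy s x with h | h | h
  · have := hp1 (mem_image_of_mem _ (show s ∈ Ico 0 x from ⟨hs.1, h⟩))
    rw [div_le_iff₀ (by linarith)] at this
    linarith
  · subst h; simp
  · have := hp2 (mem_image_of_mem _ (show s ∈ Ioc x 1 from ⟨h, hs.2⟩))
    rw [le_div_iff₀ (by linarith)] at this
    linarith

lemma mono_of19 {G : ℝ → ℝ} {x y z : ℝ} (hc : ConvexOn ℝ (Icc (0:ℝ) 1) G)
    (hx : x ∈ Icc (0:ℝ) 1) (hmin : ∀ s ∈ Icc (0:ℝ) 1, G x ≤ G s) (hz : z ∈ Icc (0:ℝ) 1)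
    (h : (x ≤ y ∧ y ≤ z) ∨ (z ≤ y ∧ y ≤ x)) : G y ≤ G z := by
  have hy : y ∈ segment ℝ x z := by
    rw [segment_eq_uIcc, mem_uIcc]; exact h
  have := hc.le_on_segment hx hz hy
  rwa [max_eq_right (hmin z hz)] at this

lemma convR19 {G : ℝ → ℝ} {x : ℝ} (hc : ConvexOn ℝ (Icc (0:ℝ) 1) G)
    (hx : x ∈ Icc (0:ℝ) 1) (hmin : ∀ s ∈ Icc (0:ℝ) 1, G x ≤ G s) :
    ConvexOn ℝ (Icc (0:ℝ) 1) (fun s => G (max s x)) := by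
  refine ⟨convex_Icc _ _, fun a ha b hb t u ht hu htu => ?_⟩
  have ha' : max a x ∈ Icc (0:ℝ) 1 := ⟨le_max_of_le_right hx.1, max_le ha.2 hx.2⟩
  have hb' : max b x ∈ Icc (0:ℝ) 1 := ⟨le_max_of_le_right hx.1, max_le hb.2 hx.2⟩
  refine le_trans ?_ (hc.2 ha' hb' ht hu htu)
  refine mono_of19 hc hx hmin (convex_Icc _ _ ha' hb' ht hu htu) (Or.inl ⟨le_max_right _ _, ?_⟩)
  simp only [smul_eq_mul]
  have e1 := mul_le_mul_of_nonneg_left (le_max_left a x) ht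
  have e2 := mul_le_mul_of_nonneg_left (le_max_left b x) hu
  have e3 := mul_le_mul_of_nonneg_left (le_max_right a x) ht
  have e4 := mul_le_mul_of_nonneg_left (le_max_right b x) hu
  have e5 : t * x + u * x = x := by rw [← add_mul, htu, one_mul]
  exact max_le (by linarith) (by linarith)

lemma convL19 {G : ℝ → ℝ} {x : ℝ} (hc : ConvexOn ℝ (Icc (0:ℝ) 1) G)
    (hx : x ∈ Icc (0:ℝ) 1) (hmin : ∀ s ∈ Icc (0:ℝ) 1, G x ≤ G s) :
    ConvexOn ℝ (Icc (0:ℝ) 1) (fun s => G (min s x)) := by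
  refine ⟨convex_Icc _ _, fun a ha b hb t u ht hu htu => ?_⟩
  have ha' : min a x ∈ Icc (0:ℝ) 1 := ⟨le_min ha.1 hx.1, min_le_of_right_le hx.2⟩
  have hb' : min b x ∈ Icc (0:ℝ) 1 := ⟨le_min hb.1 hx.1, min_le_of_right_le hx.2⟩
  refine le_trans ?_ (hc.2 ha' hb' ht hu htu)
  refine mono_of19 hc hx hmin (convex_Icc _ _ ha' hb' ht hu htu) (Or.inr ⟨?_, min_le_right _ _⟩)
  simp only [smul_eq_mul]
  have e1 := mul_le_mul_of_nonneg_left (min_le_left a x) ht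
  have e2 := mul_le_mul_of_nonneg_left (min_le_left b x) hu
  have e3 := mul_le_mul_of_nonneg_left (min_le_right a x) ht
  have e4 := mul_le_mul_of_nonneg_left (min_le_right b x) hu
  have e5 : t * x + u * x = x := by rw [← add_mul, htu, one_mul]
  exact le_min (by linarith) (by linarith)

lemma convAff19 (p i : ℝ) : ConvexOn ℝ (Icc (0:ℝ) 1) (fun s => p * s + i) := by
  refine ⟨convex_Icc _ _, fun a ha b hb t u ht hu htu => le_of_eq ?_⟩
  simp only [smul_eq_mul]
  have : u = 1 - t := by linarith
  subst this; ring

lemma hexists19 (p q i j : ℝ) : ∃ h1 h2 h3 : ℝ, (h1 ≠ 0 ∨ h2 ≠ 0 ∨ h3 ≠ 0) ∧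
    |h1| ≤ 1 ∧ |h2| ≤ 1 ∧ |h3| ≤ 1 ∧
    h1 * p + h2 * (q - p) + h3 * (2 - q) = 0 ∧
    h1 * i + h2 * (j - i) + h3 * (-1 - j) = 0 := by
  obtain ⟨v, hv, hv0⟩ := Matrix.exists_mulVec_eq_zero_iff.2
    (show (!![p, q - p, 2 - q; i, j - i, -1 - j; 0, 0, 0] : Matrix (Fin 3) (Fin 3) ℝ).det = 0 by
      simp [Matrix.det_fin_three])
  have e1 := congrFun hv0 0
  have e2 := congrFun hv0 1
  simp [Matrix.mulVec, dotProduct, Fin.sum_univ_three] at e1 e2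
  have hne : v 0 ≠ 0 ∨ v 1 ≠ 0 ∨ v 2 ≠ 0 := by
    by_contra! hcon
    apply hv
    ext k
    fin_cases k
    · exact hcon.1
    · exact hcon.2.1
    · exact hcon.2.2
  set N := |v 0| + |v 1| + |v 2| with hN
  have n0 := abs_nonneg (v 0)
  have n1 := abs_nonneg (v 1)
  have n2 := abs_nonneg (v 2)
  have hNpos : 0 < N := by
    rcases hne with h | h | h <;> have := abs_pos.2 h <;> linarith
  refine ⟨v 0 / N, v 1 / N, v 2 / N, ?_, ?_, ?_, ?_, ?_, ?_⟩
  · rcases hne with h | h | h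
    · exact Or.inl (div_ne_zero h hNpos.ne')
    · exact Or.inr (Or.inl (div_ne_zero h hNpos.ne'))
    · exact Or.inr (Or.inr (div_ne_zero h hNpos.ne'))
  · rw [abs_div, abs_of_pos hNpos, div_le_one hNpos]; linarith
  · rw [abs_div, abs_of_pos hNpos, div_le_one hNpos]; linarith
  · rw [abs_div, abs_of_pos hNpos, div_le_one hNpos]; linarith
  · have : v 0 / N * p + v 1 / N * (q - p) + v 2 / N * (2 - q) =
      (p * v 0 + (q - p) * v 1 + (2 - q) * v 2) / N := by ring
    rw [this, e1, zero_div]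
  · have : v 0 / N * i + v 1 / N * (j - i) + v 2 / N * (-1 - j) =
      (i * v 0 + (j - i) * v 1 + (-1 - j) * v 2) / N := by ring
    rw [this, e2, zero_div]

lemma memK19 {W : ℝ → ℝ} (hc : ConvexOn ℝ (Icc (0:ℝ) 1) W) (h0 : W 0 = 0) (h1 : W 1 = 1)
    (hp : ∀ s ∈ Icc (0:ℝ) 1, 0 ≤ W s) (hl : ∀ s ∈ Icc (0:ℝ) 1, 2 * s - 1 ≤ W s)
    (ho : ∀ s ∉ Icc (0:ℝ) 1, W s = 0) : W ∈ KK19 := by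
  refine ⟨?_, hc, ?_, ho⟩
  · intro a ha b hb hab
    exact mono_of19 hc (x := 0) (by simp) (by simpa [h0] using hp) hb (Or.inl ⟨ha.1, hab⟩)
  · intro s hs
    refine ⟨max_le (hp s hs) (hl s hs), ?_⟩
    have := hc.2 (by simp : (0:ℝ) ∈ Icc (0:ℝ) 1) (by simp : (1:ℝ) ∈ Icc (0:ℝ) 1)
      (by linarith [hs.2] : 0 ≤ 1 - s) hs.1 (by ring)
    simpa [h0, h1] using this

lemma tri19 {U : ℝ → ℝ} (hU : U ∈ extremePoints ℝ KK19) {x y : ℝ} (hx0 : 0 < x) (hxy : x < y)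
    (hy1 : y < 1) : U x = 0 ∨ (∃ α β : ℝ, ∀ s ∈ Icc x y, U s = α * s + β) ∨ U y = 2 * y - 1 := by
  obtain ⟨⟨hmono, hc, hb, ho⟩, hext⟩ := hU
  have hU0 : U 0 = 0 := by
    have := hb 0 (by simp)
    have h2 := le_max_left (0:ℝ) (2 * 0 - 1)
    linarith
  have hU1 : U 1 = 1 := by
    have := hb 1 (by simp)
    have h2 := le_max_right (0:ℝ) (2 * 1 - 1)
    linarith
  have hpos : ∀ s ∈ Icc (0:ℝ) 1, 0 ≤ U s := fun s hs => (le_max_left _ _).trans (hb s hs).1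
  have hlow : ∀ s ∈ Icc (0:ℝ) 1, 2 * s - 1 ≤ U s := fun s hs => (le_max_right _ _).trans (hb s hs).1
  have hx : x ∈ Icc (0:ℝ) 1 := ⟨hx0.le, by linarith⟩
  have hy : y ∈ Icc (0:ℝ) 1 := ⟨by linarith, by linarith⟩
  obtain ⟨p, hp⟩ := subgrad19 hc hx0 (by linarith)
  obtain ⟨q, hq⟩ := subgrad19 hc (by linarith : 0 < y) hy1
  have hp0 : 0 ≤ p := by
    have := hp 0 (by simp); have := hpos x hx
    by_contra! hcon
    nlinarith
  have hq2 : q ≤ 2 := by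
    have := hq 1 (by simp); have := hlow y hy
    by_contra! hcon
    nlinarith
  have hpq : p ≤ q := by
    have := hp y hy; have := hq x hx
    by_contra! hcon
    nlinarith
  obtain ⟨i, hi⟩ : ∃ i, i = U x - p * x := ⟨_, rfl⟩
  obtain ⟨j, hj⟩ : ∃ j, j = U y - q * y := ⟨_, rfl⟩
  have hp' : ∀ s ∈ Icc (0:ℝ) 1, p * s + i ≤ U s := fun s hs => by
    have := hp s hs; rw [hi]; linarith
  have hq' : ∀ s ∈ Icc (0:ℝ) 1, q * s + j ≤ U s := fun s hs => by
    have := hq s hs; rw [hj]; linarith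
  have hix : p * x + i = U x := by rw [hi]; ring
  have hjy : q * y + j = U y := by rw [hj]; ring
  clear hi hj hp hq
  -- the pieces
  obtain ⟨G, hG⟩ : ∃ G : ℝ → ℝ, ∀ s, G s = U s + ((-p) * s + (-i)) := ⟨_, fun _ => rfl⟩
  obtain ⟨H, hH⟩ : ∃ H : ℝ → ℝ, ∀ s, H s = U s + ((-q) * s + (-j)) := ⟨_, fun _ => rfl⟩
  have hGc : ConvexOn ℝ (Icc (0:ℝ) 1) G := by
    rw [show G = U + fun s => ((-p) * s + (-i)) from funext hG]; exact hc.add (convAff19 _ _)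
  have hHc : ConvexOn ℝ (Icc (0:ℝ) 1) H := by
    rw [show H = U + fun s => ((-q) * s + (-j)) from funext hH]; exact hc.add (convAff19 _ _)
  have hGx : G x = 0 := by rw [hG]; linarith
  have hHy : H y = 0 := by rw [hH]; linarith
  have hGm : ∀ s ∈ Icc (0:ℝ) 1, G x ≤ G s := fun s hs => by
    rw [hGx, hG]; linarith [hp' s hs]
  have hHm : ∀ s ∈ Icc (0:ℝ) 1, H y ≤ H s := fun s hs => by
    rw [hHy, hH]; linarith [hq' s hs]
  obtain ⟨F, hF⟩ : ∃ F : ℝ → ℝ, ∀ s, F s = H (min s y) + ((q - p) * s + (j - i)) :=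
    ⟨_, fun _ => rfl⟩
  have hFc : ConvexOn ℝ (Icc (0:ℝ) 1) F := by
    rw [show F = (fun s => H (min s y)) + fun s => ((q - p) * s + (j - i)) from funext hF]
    exact (convL19 hHc hy hHm).add (convAff19 _ _)
  have hF1 : ∀ s ≤ y, F s = G s := fun s hs => by
    rw [hF, hG, min_eq_left hs, hH]; ring
  have hF2 : ∀ s, y ≤ s → F s = (q - p) * s + (j - i) := fun s hs => by
    rw [hF, min_eq_right hs, hHy]; ring
  have hFx : F x = 0 := by rw [hF1 x hxy.le, hGx]
  have hGy0 : 0 ≤ (q - p) * y + (j - i) := by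
    have := hp' y hy; linarith
  have hFm : ∀ s ∈ Icc (0:ℝ) 1, F x ≤ F s := fun s hs => by
    rw [hFx]
    rcases le_total s y with h | h
    · rw [hF1 s h, ← hGx]; exact hGm s hs
    · rw [hF2 s h]; nlinarith
  obtain ⟨A, hA⟩ : ∃ A : ℝ → ℝ, ∀ s, A s = G (min s x) + (p * s + i) := ⟨_, fun _ => rfl⟩
  obtain ⟨B, hB⟩ : ∃ B : ℝ → ℝ, ∀ s, B s = F (max s x) := ⟨_, fun _ => rfl⟩
  obtain ⟨C, hC⟩ : ∃ C : ℝ → ℝ, ∀ s, C s = H (max s y) := ⟨_, fun _ => rfl⟩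
  have hAc : ConvexOn ℝ (Icc (0:ℝ) 1) A := by
    rw [show A = (fun s => G (min s x)) + fun s => (p * s + i) from funext hA]
    exact (convL19 hGc hx hGm).add (convAff19 _ _)
  have hBc : ConvexOn ℝ (Icc (0:ℝ) 1) B := by
    rw [show B = (fun s => F (max s x)) from funext hB]
    exact convR19 hFc hx hFm
  have hCc : ConvexOn ℝ (Icc (0:ℝ) 1) C := by
    rw [show C = (fun s => H (max s y)) from funext hC]
    exact convR19 hHc hy hHm
  have hA1 : ∀ s ≤ x, A s = U s := fun s hs => by rw [hA, min_eq_left hs, hG]; ring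
  have hA2 : ∀ s, x ≤ s → A s = p * s + i := fun s hs => by rw [hA, min_eq_right hs, hGx]; ring
  have hB1 : ∀ s ≤ x, B s = 0 := fun s hs => by rw [hB, max_eq_right hs, hFx]
  have hB2 : ∀ s, x ≤ s → s ≤ y → B s = U s - (p * s + i) := fun s hs h2 => by
    rw [hB, max_eq_left hs, hF1 s h2, hG]; ring
  have hB3 : ∀ s, y ≤ s → B s = (q - p) * s + (j - i) := fun s hs => by
    rw [hB, max_eq_left (by linarith), hF2 s hs]
  have hC1 : ∀ s ≤ y, C s = 0 := fun s hs => by rw [hC, max_eq_right hs, hHy]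
  have hC2 : ∀ s, y ≤ s → C s = U s - (q * s + j) := fun s hs => by
    rw [hC, max_eq_left hs, hH]; ring
  clear hA hB hC hF hF1 hF2 hFx hFm hFc hGc hHc hG hH hGx hHy hGm hHm
  have hsum : ∀ s, A s + B s + C s = U s := fun s => by
    rcases le_total s x with h | h
    · rw [hA1 s h, hB1 s h, hC1 s (by linarith)]; ring
    · rcases le_total s y with h' | h'
      · rw [hA2 s h, hB2 s h h', hC1 s h']; ring
      · rw [hA2 s h, hB3 s h', hC2 s h']; ring
  have hApos : ∀ s ∈ Icc (0:ℝ) 1, 0 ≤ A s := fun s hs => by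
    rcases le_total s x with h | h
    · rw [hA1 s h]; exact hpos s hs
    · rw [hA2 s h]; nlinarith [hpos x hx]
  have hBpos : ∀ s ∈ Icc (0:ℝ) 1, 0 ≤ B s := fun s hs => by
    rcases le_total s x with h | h
    · rw [hB1 s h]
    · rcases le_total s y with h' | h'
      · rw [hB2 s h h']; linarith [hp' s hs]
      · rw [hB3 s h']; nlinarith
  have hCpos : ∀ s ∈ Icc (0:ℝ) 1, 0 ≤ C s := fun s hs => by
    rcases le_total s y with h | h
    · rw [hC1 s h]
    · rw [hC2 s h]; linarith [hq' s hs]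
  have hAlow : ∀ s ∈ Icc (0:ℝ) 1, p * s + i ≤ A s := fun s hs => by
    rcases le_total s x with h | h
    · rw [hA1 s h]; exact hp' s hs
    · rw [hA2 s h]
  have hBlow : ∀ s ∈ Icc (0:ℝ) 1, (q - p) * s + (j - i) ≤ B s := fun s hs => by
    rcases le_total s x with h | h
    · rw [hB1 s h]; nlinarith [hq' x hx]
    · rcases le_total s y with h' | h'
      · rw [hB2 s h h']; linarith [hq' s hs]
      · rw [hB3 s h']
  have hClow : ∀ s ∈ Icc (0:ℝ) 1, (2 - q) * s + (-1 - j) ≤ C s := fun s hs => by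
    rcases le_total s y with h | h
    · rw [hC1 s h]; nlinarith [hlow y hy]
    · rw [hC2 s h]; linarith [hlow s hs]
  obtain ⟨h1, h2, h3, hne, a1, a2, a3, eq1, eq2⟩ := hexists19 p q i j
  rw [abs_le] at a1 a2 a3
  -- admissibility of positive combinations
  have key : ∀ k1 k2 k3 : ℝ, 0 ≤ k1 → 0 ≤ k2 → 0 ≤ k3 →
      k1 * p + k2 * (q - p) + k3 * (2 - q) = 2 →
      k1 * i + k2 * (j - i) + k3 * (-1 - j) = -1 →
      (Icc (0:ℝ) 1).indicator (fun s => k1 * A s + k2 * B s + k3 * C s) ∈ KK19 := by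
    intro k1 k2 k3 hk1 hk2 hk3 e1 e2
    have hin : ∀ s ∈ Icc (0:ℝ) 1, (Icc (0:ℝ) 1).indicator
      (fun s => k1 * A s + k2 * B s + k3 * C s) s = k1 * A s + k2 * B s + k3 * C s :=
      fun s hs => indicator_of_mem hs _
    refine memK19 ?_ ?_ ?_ ?_ ?_ ?_
    · refine ConvexOn.congr (f := fun s => k1 * A s + k2 * B s + k3 * C s) ?_
        (fun s hs => (hin s hs).symm)
      exact ((hAc.smul hk1).add (hBc.smul hk2)).add (hCc.smul hk3)
    · rw [hin 0 (by simp), hA1 0 hx0.le, hB1 0 hx0.le, hC1 0 (by linarith), hU0]; ring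
    · rw [hin 1 (by simp), hA2 1 (by linarith), hB3 1 hy1.le, hC2 1 hy1.le, hU1]
      linear_combination e1 + e2
    · intro s hs
      rw [hin s hs]
      have := mul_nonneg hk1 (hApos s hs)
      have := mul_nonneg hk2 (hBpos s hs)
      have := mul_nonneg hk3 (hCpos s hs)
      linarith
    · intro s hs
      rw [hin s hs]
      have t1 := mul_le_mul_of_nonneg_left (hAlow s hs) hk1
      have t2 := mul_le_mul_of_nonneg_left (hBlow s hs) hk2
      have t3 := mul_le_mul_of_nonneg_left (hClow s hs) hk3
      have : 2 * s - 1 = k1 * (p * s + i) + k2 * ((q - p) * s + (j - i)) +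
        k3 * ((2 - q) * s + (-1 - j)) := by linear_combination (-s) * e1 - e2
      linarith
    · intro s hs
      exact indicator_of_notMem hs _
  have m1 := key (1 + h1) (1 + h2) (1 + h3) (by linarith) (by linarith) (by linarith)
    (by linear_combination eq1) (by linear_combination eq2)
  have m2 := key (1 - h1) (1 - h2) (1 - h3) (by linarith) (by linarith) (by linarith)
    (by linear_combination -eq1) (by linear_combination -eq2)
  have hE := hext m1 m2 (by
    refine ⟨1/2, 1/2, by norm_num, by norm_num, by norm_num, ?_⟩
    ext s
    by_cases hs : s ∈ Icc (0:ℝ) 1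
    · simp only [Pi.add_apply, Pi.smul_apply, smul_eq_mul, indicator_of_mem hs]
      rw [← hsum s]; ring
    · simp only [Pi.add_apply, Pi.smul_apply, smul_eq_mul, indicator_of_notMem hs]
      rw [ho s hs]; ring)
  have hV : ∀ s ∈ Icc (0:ℝ) 1, h1 * A s + h2 * B s + h3 * C s = 0 := fun s hs => by
    have := congrFun hE s
    rw [indicator_of_mem hs, ← hsum s] at this
    linear_combination this
  by_cases z1 : h1 = 0
  · by_cases z2 : h2 = 0
    · have z3 : h3 ≠ 0 := by
        rcases hne with h | h | h
        · exact absurd z1 h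
        · exact absurd z2 h
        · exact h
      right; right
      subst z1 z2
      have e1 : 2 - q = 0 := by
        have : h3 * (2 - q) = 0 := by linarith
        exact (mul_eq_zero.1 this).resolve_left z3
      have e2 : -1 - j = 0 := by
        have : h3 * (-1 - j) = 0 := by linarith
        exact (mul_eq_zero.1 this).resolve_left z3
      rw [← hjy, show q = 2 by linarith, show j = -1 by linarith]; ring
    · right; left
      refine ⟨p, i, fun s hs => ?_⟩
      have := hV s ⟨by linarith [hs.1], by linarith [hs.2]⟩
      rw [z1, hB2 s hs.1 hs.2, hC1 s hs.2] at this
      have : h2 * (U s - (p * s + i)) = 0 := by linarith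
      linarith [(mul_eq_zero.1 this).resolve_left z2]
  · left
    have := hV x hx
    rw [hA1 x le_rfl, hB1 x le_rfl, hC1 x hxy.le] at this
    have : h1 * U x = 0 := by linarith
    exact (mul_eq_zero.1 this).resolve_left z1

theorem stmt19 (U : ℝ → ℝ)
    (hU : U ∈ Set.extremePoints ℝ
      {W : ℝ → ℝ | MonotoneOn W (Set.Icc (0:ℝ) 1) ∧
        ConvexOn ℝ (Set.Icc (0:ℝ) 1) W ∧
        (∀ s ∈ Set.Icc (0:ℝ) 1, max 0 (2 * s - 1) ≤ W s ∧ W s ≤ s) ∧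
        (∀ s ∉ Set.Icc (0:ℝ) 1, W s = 0)}) :
    ∃ smin smax : ℝ, 0 ≤ smin ∧ smin ≤ smax ∧ smax ≤ 1 ∧
      (∃ α β : ℝ, ∀ s ∈ Set.Icc smin smax, U s = α * s + β) ∧
      (∀ s ∈ Set.Icc (0:ℝ) 1, s ∉ Set.Ioo smin smax → U s = max 0 (2 * s - 1)) := by
  have hU' : U ∈ extremePoints ℝ KK19 := hU
  obtain ⟨⟨hmono, hc, hb, ho⟩, -⟩ := hU
  have hpos : ∀ s ∈ Icc (0:ℝ) 1, 0 ≤ U s := fun s hs => (le_max_left _ _).trans (hb s hs).1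
  have hlow : ∀ s ∈ Icc (0:ℝ) 1, 2 * s - 1 ≤ U s := fun s hs => (le_max_right _ _).trans (hb s hs).1
  have hU0 : U 0 = 0 := by
    have := hb 0 (by simp)
    have := hpos 0 (by simp)
    linarith
  have hU1 : U 1 = 1 := by
    have := hb 1 (by simp)
    have := hlow 1 (by simp)
    linarith
  -- slopes at most two
  have hslope : ∀ a ∈ Icc (0:ℝ) 1, ∀ b ∈ Icc (0:ℝ) 1, a ≤ b → U b - U a ≤ 2 * (b - a) := by
    intro a ha b hb' hab
    rcases hab.eq_or_lt with h | h
    · subst h; simp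
    rcases hb'.2.eq_or_lt with h' | h'
    · subst h'; rw [hU1]; linarith [hlow a ha]
    have := hc.slope_mono_adjacent ha (by simp : (1:ℝ) ∈ Icc (0:ℝ) 1) h h'
    have h3 : (U 1 - U b) / (1 - b) ≤ 2 := by
      rw [div_le_iff₀ (by linarith), hU1]; linarith [hlow b hb']
    have h4 := this.trans h3
    rwa [div_le_iff₀ (by linarith)] at h4
  have hcont : ContinuousOn U (Icc (0:ℝ) 1) := by
    have : LipschitzOnWith 2 U (Icc (0:ℝ) 1) := by
      refine LipschitzOnWith.of_le_add_mul 2 fun a ha b hb' => ?_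
      rw [Real.dist_eq]
      rcases le_total a b with h | h
      · have := hmono ha hb' h
        have := abs_nonneg (a - b)
        push_cast
        linarith
      · have := hslope b hb' a ha h
        have := le_abs_self (a - b)
        push_cast
        linarith
    exact this.continuousOn
  have hz : IsCompact (Icc (0:ℝ) 1 ∩ U ⁻¹' {0}) :=
    isCompact_Icc.of_isClosed_subset (hcont.preimage_isClosed_of_isClosed isClosed_Icc
      isClosed_singleton) inter_subset_left
  have hcont2 : ContinuousOn (fun s => U s - (2 * s - 1)) (Icc (0:ℝ) 1) :=
    hcont.sub (by fun_prop)
  have ht : IsCompact (Icc (0:ℝ) 1 ∩ (fun s => U s - (2 * s - 1)) ⁻¹' {0}) :=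
    isCompact_Icc.of_isClosed_subset (hcont2.preimage_isClosed_of_isClosed isClosed_Icc
      isClosed_singleton) inter_subset_left
  obtain ⟨a, ⟨ha, haz⟩, hamax⟩ := hz.exists_isGreatest ⟨0, by simp, hU0⟩
  obtain ⟨b, ⟨hb', hbz⟩, hbmin⟩ := ht.exists_isLeast ⟨1, by simp, by simp [hU1]; norm_num⟩
  simp only [mem_preimage, mem_singleton_iff] at haz hbz
  have ha2 : a ≤ 1 / 2 := by linarith [hlow a ha]
  have hb2 : 1 / 2 ≤ b := by linarith [hpos b hb']
  refine ⟨a, b, ha.1, by linarith, hb'.2, ?_, ?_⟩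
  · rcases (show a ≤ b by linarith).eq_or_lt with hab | hab
    · refine ⟨0, U a, fun s hs => ?_⟩
      have : s = a := le_antisymm (by linarith [hs.2]) hs.1
      rw [this]; ring
    have haff : ∀ x y, a < x → x < y → y < b → ∃ α β : ℝ, ∀ s ∈ Icc x y, U s = α * s + β := by
      intro x y h1 h2 h3
      rcases tri19 hU' (by linarith [ha.1] : 0 < x) h2 (by linarith [hb'.2]) with h | h | h
      · have := hamax ⟨⟨by linarith [ha.1], by linarith [hb'.2]⟩, h⟩
        linarith
      · exact h
      · have := hbmin ⟨⟨by linarith [ha.1], by linarith [hb'.2]⟩,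
          (by simp only [mem_preimage, mem_singleton_iff]; linarith : y ∈ _ ⁻¹' _)⟩
        linarith
    obtain ⟨m, hm1, hm2⟩ := exists_between hab
    obtain ⟨n, hn1, hn2⟩ := exists_between hm2
    obtain ⟨α, β, hαβ⟩ := haff m n hm1 hn1 hn2
    refine ⟨α, β, ?_⟩
    have hopen : EqOn U (fun s => α * s + β) (Ioo a b) := by
      intro s hs
      obtain ⟨γ, δ, hγ⟩ := haff (min s m) (max s n) (lt_min hs.1 hm1)
        (lt_of_le_of_lt (min_le_right _ _) (lt_of_lt_of_le hn1 (le_max_right _ _)))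
        (max_lt hs.2 hn2)
      have k1 := hγ m ⟨min_le_right _ _, hn1.le.trans (le_max_right _ _)⟩
      have k2 := hγ n ⟨(min_le_right _ _).trans hn1.le, le_max_right _ _⟩
      have k3 := hγ s ⟨min_le_left _ _, le_max_left _ _⟩
      have l1 := hαβ m ⟨le_rfl, hn1.le⟩
      have l2 := hαβ n ⟨hn1.le, le_rfl⟩
      have e : (γ - α) * (n - m) = 0 := by linear_combination k1 - k2 - l1 + l2
      have e' : γ = α := by
        have := (mul_eq_zero.1 e).resolve_right (by linarith)
        linarith
      subst e'
      simp only
      linarith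
    have hcl := hopen.of_subset_closure (t := Icc a b)
      (hcont.mono (Icc_subset_Icc ha.1 hb'.2)) (by fun_prop) Ioo_subset_Icc_self
      (by rw [closure_Ioo hab.ne])
    exact fun s hs => hcl hs
  · intro s hs hns
    by_cases h : s ≤ a
    · have := hmono hs ha h
      rw [max_eq_left (by linarith)]
      linarith [hpos s hs]
    · have hsb : b ≤ s := by
        by_contra! hcon
        exact hns ⟨by linarith, hcon⟩
      have := hslope b hb' s hs hsb
      rw [max_eq_right (by linarith)]
      linarith [hlow s hs]
end
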